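/- Let D be a convex drawing of K_n in the plane with star vertex v_⋆, with m ≥ 2 bad edges and a labeling satisfying sidedness and nestedness, bad edges b_i = {v_i, v_i+1} with v_1 < … < v_m, smallest and largest witnesses w_i^L and w_i^R of b_i, and for 1 ≤ i ≤ m−1 let L_i = {x : w_{i+1}^R < x < w_i^L} and R_i = {x : v_i + 1 ≤ x ≤ v_{i+1}}. Then for every i with 1 ≤ i ≤ m−1, no edge {u,v} with u ∈ L_i and v ∈ R_i crosses two star edges {z_1, v_⋆} and {z_2, v_⋆} with z_1 < u < z_2 and z_1, z_2 ∈ L_i. -/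

import Mathlib

open Set

/-- Cyclic successor on `Fin m` (indices modulo `m`). -/
def finCycSucc {m : ℕ} (i : Fin m) : Fin m := ⟨((i : ℕ) + 1) % m, Nat.mod_lt _ i.pos⟩

/-- `p` is a proper (transversal) crossing point of the arcs `α` and `β` : `p` lies on both arcs
and, locally around `p`, the arc `β` has points in two different sides of `α`
(it passes from one side of `α` to the other). -/
def ProperCrossingAt (α β : Set (ℝ × ℝ)) (p : ℝ × ℝ) : Prop :=
  p ∈ α ∩ β ∧
    ∀ U ∈ nhds p, ∃ V ∈ nhds p, V ⊆ U ∧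
      ∃ q₁ ∈ β ∩ V, ∃ q₂ ∈ β ∩ V, q₁ ∉ α ∧ q₂ ∉ α ∧
        connectedComponentIn (V \ α) q₁ ≠ connectedComponentIn (V \ α) q₂

/-- A simple drawing of the complete graph `K n` in the plane: `n` distinct vertex points,
a simple arc joining each pair of distinct vertices, no edge passing through another vertex,
and any two (distinct) edges meeting in at most one point, which is either a common endpoint
or a proper crossing. -/
structure SimpleDrawing (n : ℕ) where
  vert : Fin n → ℝ × ℝ
  vert_inj : Function.Injective vert
  arc : Fin n → Fin n → Set (ℝ × ℝ)
  arc_symm : ∀ i j, arc i j = arc j i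
  arc_simple : ∀ i j, i ≠ j → ∃ f : ℝ → ℝ × ℝ,
    ContinuousOn f (Icc (0:ℝ) 1) ∧ InjOn f (Icc (0:ℝ) 1) ∧
    f '' Icc (0:ℝ) 1 = arc i j ∧ f 0 = vert i ∧ f 1 = vert j
  no_through_vertex : ∀ i j k, i ≠ j → vert k ∈ arc i j → k = i ∨ k = j
  inter_subsingleton : ∀ i j k l, i ≠ j → k ≠ l → s(i, j) ≠ s(k, l) →
    (arc i j ∩ arc k l).Subsingleton
  inter_proper : ∀ i j k l, i ≠ j → k ≠ l → s(i, j) ≠ s(k, l) →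
    ∀ p ∈ arc i j ∩ arc k l,
      (∃ a, (a = i ∨ a = j) ∧ (a = k ∨ a = l) ∧ p = vert a) ∨
      ProperCrossingAt (arc i j) (arc k l) p

namespace SimpleDrawing

variable {n : ℕ} (D : SimpleDrawing n)

/-- The arc realizing an (unordered) edge. -/
def earc : Sym2 (Fin n) → Set (ℝ × ℝ) := Sym2.lift ⟨D.arc, D.arc_symm⟩

/-- Two (distinct) edges cross: they share a point that is not a common endpoint. -/
def Crosses (e e' : Sym2 (Fin n)) : Prop :=
  e ≠ e' ∧ ∃ p ∈ D.earc e ∩ D.earc e', ¬∃ a, a ∈ e ∧ a ∈ e' ∧ p = D.vert a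

/-- A set of edges is plane if no two of its edges cross. -/
def IsPlane (E : Set (Sym2 (Fin n))) : Prop :=
  ∀ e ∈ E, ∀ e' ∈ E, ¬D.Crosses e e'

/-- A plane subdrawing: a plane set of (genuine, non-loop) edges of the drawing. -/
def IsPlaneSub (E : Set (Sym2 (Fin n))) : Prop :=
  (∀ e ∈ E, ¬e.IsDiag) ∧ D.IsPlane E

/-- A maximal plane subdrawing: no further edge can be added while keeping the set plane. -/
def IsMaximalPlaneSub (E : Set (Sym2 (Fin n))) : Prop :=
  D.IsPlaneSub E ∧ ∀ e, ¬e.IsDiag → e ∉ E → ¬D.IsPlaneSub (insert e E)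

/-- The triangle of the drawing spanned by three vertices: the union of the three arcs. -/
def triangle (a b c : Fin n) : Set (ℝ × ℝ) := D.arc a b ∪ D.arc b c ∪ D.arc a c

/-- `S` is a side of the triangle on `a b c`: the closure of a connected component of the
complement of the triangle. -/
def IsSideOf (S : Set (ℝ × ℝ)) (a b c : Fin n) : Prop :=
  ∃ p, p ∉ D.triangle a b c ∧ S = closure (connectedComponentIn (D.triangle a b c)ᶜ p)

/-- `S` is a convex side of the triangle on `a b c`: every edge of the drawing with both
endpoints in `S` is contained in `S`. -/
def IsConvexSideOf (S : Set (ℝ × ℝ)) (a b c : Fin n) : Prop :=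
  D.IsSideOf S a b c ∧
    ∀ i j : Fin n, i ≠ j → D.vert i ∈ S → D.vert j ∈ S → D.arc i j ⊆ S

/-- A convex drawing: every triangle has a convex side. -/
def Convex : Prop :=
  ∀ a b c : Fin n, a ≠ b → b ≠ c → a ≠ c → ∃ S, D.IsConvexSideOf S a b c

/-- A plane Hamiltonian cycle: a plane set of `n` edges forming a cycle through all vertices. -/
def IsPlaneHamCycle (E : Set (Sym2 (Fin n))) : Prop :=
  D.IsPlane E ∧ ∃ c : ZMod n → Fin n, Function.Bijective c ∧
    E = {e | ∃ k : ZMod n, e = s(c k, c (k + 1))}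

/-- A plane Hamiltonian path from `s` to `t`: a plane set of `n-1` edges forming a path
through all `n` vertices with endpoints `s` and `t`. -/
def IsPlaneHamPath (E : Set (Sym2 (Fin n))) (s t : Fin n) : Prop :=
  D.IsPlane E ∧ ∃ p : Fin n → Fin n, Function.Bijective p ∧
    (∀ i : Fin n, (i : ℕ) = 0 → p i = s) ∧
    (∀ i : Fin n, (i : ℕ) = n - 1 → p i = t) ∧
    E = {e | ∃ i j : Fin n, (j : ℕ) = (i : ℕ) + 1 ∧ e = s(p i, p j)}

/-- The edge from `a` towards `b` emanates (at `a`) into the set `C`. -/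
def EmanatesInto (a b : Fin n) (C : Set (ℝ × ℝ)) : Prop :=
  ∃ U ∈ nhds (D.vert a), (D.arc a b ∩ U) \ {D.vert a} ⊆ C

/-- At the vertex `vs`, the edges towards `b` and towards `d` emanate into different
connected components of the complement of the triangle on `vs`, `a`, `c`;
i.e. the pair `{a, c}` locally separates `b` from `d` in the rotation at `vs`. -/
def SeparatesAt (vs a c b d : Fin n) : Prop :=
  ∃ p q : ℝ × ℝ, p ∉ D.triangle vs a c ∧ q ∉ D.triangle vs a c ∧
    connectedComponentIn (D.triangle vs a c)ᶜ p ≠ connectedComponentIn (D.triangle vs a c)ᶜ q ∧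
    D.EmanatesInto vs b (connectedComponentIn (D.triangle vs a c)ᶜ p) ∧
    D.EmanatesInto vs d (connectedComponentIn (D.triangle vs a c)ᶜ q)

/-- `lab` labels the `n-1` non-star vertices according to the cyclic order (the rotation)
in which the star edges emanate from the star vertex `vs`: it is a bijection onto the
non-star vertices such that, for any indices `i < j < k < l`, the edges towards `lab i` and
`lab k` locally separate the edges towards `lab j` and `lab l` at `vs`. -/
def IsRotationLabeling (vs : Fin n) (lab : Fin (n - 1) → Fin n) : Prop :=
  Function.Injective lab ∧ range lab = {x | x ≠ vs} ∧
    ∀ i j k l : Fin (n - 1), i < j → j < k → k < l →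
      D.SeparatesAt vs (lab i) (lab k) (lab j) (lab l)

/-- The edge `{lab x, lab (x+1)}` (indices mod `n-1`) is a bad edge with witness `w`:
it crosses the star edge `{lab w, vs}`. -/
def BadWitness (vs : Fin n) (lab : Fin (n - 1) → Fin n) (x w : Fin (n - 1)) : Prop :=
  D.Crosses s(lab x, lab (finCycSucc x)) s(lab w, vs)

/-- The non-star edge `{lab x, lab y}` is star-crossing: it crosses some star edge. -/
def StarCrossing (vs : Fin n) (lab : Fin (n - 1) → Fin n) (x y : Fin (n - 1)) : Prop :=
  ∃ w : Fin (n - 1), D.Crosses s(lab x, lab y) s(lab w, vs)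

end SimpleDrawing

/-- Four indices appear in this cyclic order. -/
def CyclicOrdered {m : ℕ} (a b c d : Fin m) : Prop :=
  (a < b ∧ b < c ∧ c < d) ∨ (b < c ∧ c < d ∧ d < a) ∨
  (c < d ∧ d < a ∧ a < b) ∨ (d < a ∧ a < b ∧ b < c)

/-- `p` and `q` are not separated by `K`: some connected set avoiding `K` contains both. -/
def SameSide {X : Type*} [TopologicalSpace X] (K : Set X) (p q : X) : Prop :=
  ∃ S, IsPreconnected S ∧ S ⊆ Kᶜ ∧ p ∈ S ∧ q ∈ S

namespace SameSide

variable {X Y : Type*} [TopologicalSpace X] [TopologicalSpace Y] {K K' : Set X} {p q r : X}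

theorem refl (hp : p ∉ K) : SameSide K p p :=
  ⟨{p}, isPreconnected_singleton, by simpa using hp, rfl, rfl⟩

theorem symm (h : SameSide K p q) : SameSide K q p :=
  let ⟨S, h1, h2, h3, h4⟩ := h
  ⟨S, h1, h2, h4, h3⟩

theorem trans (h : SameSide K p q) (h' : SameSide K q r) : SameSide K p r := by
  obtain ⟨S, h1, h2, h3, h4⟩ := h
  obtain ⟨S', h1', h2', h3', h4'⟩ := h'
  exact ⟨S ∪ S', h1.union q h4 h3' h1', union_subset h2 h2', Or.inl h3, Or.inr h4'⟩

theorem mono (h : SameSide K p q) (hK : K' ⊆ K) : SameSide K' p q :=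
  let ⟨S, h1, h2, h3, h4⟩ := h
  ⟨S, h1, h2.trans (compl_subset_compl.2 hK), h3, h4⟩

theorem left_notMem (h : SameSide K p q) : p ∉ K :=
  let ⟨_, _, h2, h3, _⟩ := h
  h2 h3

theorem right_notMem (h : SameSide K p q) : q ∉ K := h.symm.left_notMem

theorem image (e : X ≃ₜ Y) (h : SameSide K p q) : SameSide (e '' K) (e p) (e q) := by
  obtain ⟨S, h1, h2, h3, h4⟩ := h
  refine ⟨e '' S, h1.image _ e.continuous.continuousOn, ?_, ⟨_, h3, rfl⟩, ⟨_, h4, rfl⟩⟩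
  rw [← image_compl_eq e.bijective]
  exact image_mono h2

theorem iff_mem_connectedComponentIn :
    SameSide K p q ↔ q ∈ connectedComponentIn Kᶜ p := by
  constructor
  · rintro ⟨S, h1, h2, h3, h4⟩
    exact h1.subset_connectedComponentIn h3 h2 h4
  · intro h
    have hp : p ∈ Kᶜ := by
      by_contra hp
      simp [connectedComponentIn_eq_empty hp] at h
    exact ⟨_, isPreconnected_connectedComponentIn, connectedComponentIn_subset _ _,
      mem_connectedComponentIn hp, h⟩

theorem eventually [LocallyConnectedSpace X] (hK : IsClosed K) (hp : p ∉ K) :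
    ∀ᶠ q in nhds p, SameSide K p q := by
  filter_upwards [(hK.isOpen_compl.connectedComponentIn (x := p)).mem_nhds
    (mem_connectedComponentIn hp)] with q hq
  exact iff_mem_connectedComponentIn.2 hq

end SameSide

/-- On `K` the function `z ↦ (z - p) / (z - q)` has a continuous logarithm. -/
def HasLog (K : Set ℂ) (p q : ℂ) : Prop :=
  ∃ g : ℂ → ℂ, ContinuousOn g K ∧ ∀ z ∈ K, Complex.exp (g z) * (z - q) = z - p

namespace HasLog

variable {K : Set ℂ} {p q r : ℂ}

theorem symm (h : HasLog K p q) : HasLog K q p := by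
  obtain ⟨g, hg, h⟩ := h
  refine ⟨fun z => -g z, hg.neg, fun z hz => ?_⟩
  rw [← h z hz, ← mul_assoc, ← Complex.exp_add]
  simp

theorem trans (h : HasLog K p q) (h' : HasLog K q r) : HasLog K p r := by
  obtain ⟨g, hg, h⟩ := h
  obtain ⟨g', hg', h'⟩ := h'
  refine ⟨fun z => g z + g' z, hg.add hg', fun z hz => ?_⟩
  rw [Complex.exp_add, mul_assoc, h' z hz, h z hz]

theorem eventually (hK : IsClosed K) (hp : p ∉ K) : ∀ᶠ q in nhds p, HasLog K q p := by
  obtain ⟨ε, hε, hball⟩ := Metric.isOpen_iff.1 hK.isOpen_compl p hp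
  filter_upwards [Metric.ball_mem_nhds p hε] with q hq
  have key : ∀ z ∈ K, z - p ≠ 0 ∧ ‖(p - q) / (z - p)‖ < 1 := by
    intro z hz
    have h1 : ε ≤ ‖z - p‖ := by
      by_contra! h
      exact hball (by simpa [dist_eq_norm] using h : z ∈ Metric.ball p ε) hz
    have h0 : 0 < ‖z - p‖ := hε.trans_le h1
    refine ⟨norm_pos_iff.1 h0, ?_⟩
    rw [norm_div, div_lt_one h0]
    rw [Metric.mem_ball', dist_eq_norm] at hq
    exact hq.trans_le h1
  refine ⟨fun z => Complex.log (1 + (p - q) / (z - p)), ?_, fun z hz => ?_⟩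
  · refine ContinuousOn.clog ?_ fun z hz => Complex.mem_slitPlane_of_norm_lt_one (key z hz).2
    exact continuousOn_const.add (continuousOn_const.div (by fun_prop) fun z hz => (key z hz).1)
  · have h1 := (key z hz).1
    rw [Complex.exp_log (Complex.slitPlane_ne_zero
      (Complex.mem_slitPlane_of_norm_lt_one (key z hz).2))]
    field_simp
    ring

theorem of_sameSide (hK : IsClosed K) (h : SameSide K p q) : HasLog K p q := by
  obtain ⟨S, h1, h2, h3, h4⟩ := h
  refine h1.induction₂ (HasLog K) (fun x hx => ?_) ?_ ?_ h3 h4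
  · filter_upwards [nhdsWithin_le_nhds (eventually hK (h2 hx))] with y hy using hy.symm
  · intro x y z _ _ _ hxy hyz
    exact hxy.trans hyz
  · intro x y _ _ hxy
    exact hxy.symm

end HasLog

/-- A continuous function with `exp ∘ d = 1` on a preconnected set is constant there. -/
theorem eq_of_exp_eq_one {X : Type*} [TopologicalSpace X] {S : Set X} (hS : IsPreconnected S)
    {d : X → ℂ} (hd : ContinuousOn d S) (h : ∀ x ∈ S, Complex.exp (d x) = 1) {x y : X}
    (hx : x ∈ S) (hy : y ∈ S) : d x = d y := by
  have key : ∀ x ∈ S, ∃ n : ℤ, d x = n * (2 * Real.pi * Complex.I) := fun x hx =>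
    Complex.exp_eq_one_iff.1 (h x hx)
  have hne : (2 * Real.pi * Complex.I : ℂ) ≠ 0 := Complex.two_pi_I_ne_zero
  have hT : IsDiscrete (range ((↑) : ℤ → ℝ)) :=
    Int.isClosedEmbedding_coe_real.isEmbedding.isDiscrete_range
  have hc : ContinuousOn (fun x => (d x / (2 * Real.pi * Complex.I)).re) S :=
    Complex.continuous_re.comp_continuousOn (hd.div_const _)
  have := hS.constant_of_mapsTo hT hc (fun x hx => ?_) hx hy
  · obtain ⟨n, hn⟩ := key x hx
    obtain ⟨k, hk⟩ := key y hy
    simp only [hn, hk, mul_div_cancel_right₀ _ hne, Complex.intCast_re] at this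
    rw [hn, hk]
    have : n = k := by exact_mod_cast this
    rw [this]
  · obtain ⟨n, hn⟩ := key x hx
    exact ⟨n, by simp only [hn, mul_div_cancel_right₀ _ hne, Complex.intCast_re]⟩

/-- The identity of a circle has no continuous logarithm. -/
theorem no_log_on_circle (h : ℂ → ℂ) (hh : Continuous h) (p : ℂ) (R : ℝ) (hR : 0 < R)
    (H : ∀ z, ‖z - p‖ = R → Complex.exp (h z) = z - p) : False := by
  set k : ℝ → ℂ := fun θ => h (p + R * Complex.exp (θ * Complex.I)) - θ * Complex.I -
    h (p + R) with hk
  have hkc : Continuous k := by fun_prop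
  have hk1 : ∀ θ ∈ (univ : Set ℝ), Complex.exp (k θ) = 1 := by
    intro θ _
    have hR' : (R : ℂ) ≠ 0 := by exact_mod_cast hR.ne'
    rw [hk]
    simp only
    rw [Complex.exp_sub, Complex.exp_sub, H, H]
    · have := Complex.exp_ne_zero (θ * Complex.I)
      simp only [add_sub_cancel_left]
      field_simp
    · simp [abs_of_pos hR]
    · simp [Complex.norm_exp_ofReal_mul_I, abs_of_pos hR]
  have := eq_of_exp_eq_one isPreconnected_univ hkc.continuousOn hk1 (mem_univ 0)
    (mem_univ (2 * Real.pi))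
  simp [hk, Complex.exp_two_pi_mul_I] at this

theorem exists_log_of_continuous {A : Type*} [TopologicalSpace A] [SimplyConnectedSpace A]
    [LocallyPathConnectedSpace A] (F : A → ℂ) (hF : Continuous F) (h0 : ∀ a, F a ≠ 0) :
    ∃ h : A → ℂ, Continuous h ∧ ∀ a, Complex.exp (h a) = F a := by
  obtain ⟨a₀⟩ : Nonempty A := inferInstance
  obtain ⟨f, ⟨-, hf⟩, -⟩ := Complex.isCoveringMapOn_exp.existsUnique_continuousMap_lifts
    ⟨F, hF⟩ (a₀ := a₀) (Complex.exp_log (h0 a₀)) (fun a => by simpa using h0 a)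
  exact ⟨f, f.continuous, fun a => congrFun hf a⟩

theorem isOpen_component {K : Set ℂ} (hK : IsClosed K) (p : ℂ) :
    IsOpen {z | SameSide K p z} := by
  have : {z | SameSide K p z} = connectedComponentIn Kᶜ p := by
    ext z
    exact SameSide.iff_mem_connectedComponentIn
  rw [this]
  exact hK.isOpen_compl.connectedComponentIn

theorem HasLog.sameSide_of_bounded {K : Set ℂ} {p q : ℂ} (hK : IsCompact K) (hp : p ∉ K)
    (h : HasLog K p q) (hb : Bornology.IsBounded {z | SameSide K p z}) :
    SameSide K p q := by
  classical
  by_contra hq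
  obtain ⟨g, hg, hgK⟩ := h
  obtain ⟨G, hG⟩ := ContinuousMap.exists_restrict_eq hK.isClosed
    ⟨K.domRestrict g, continuousOn_iff_continuous_domRestrict.1 hg⟩
  have hGK : ∀ z ∈ K, G z = g z := fun z hz => congrArg (fun f => f ⟨z, hz⟩) hG
  set U := {z | SameSide K p z} with hU
  have hUo : IsOpen U := isOpen_component hK.isClosed p
  have hfr : frontier U ⊆ K := by
    intro z hz
    by_contra hzK
    rw [frontier, hUo.interior_eq] at hz
    obtain ⟨w, hw, hw'⟩ := mem_closure_iff_nhds.1 hz.1 _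
      (SameSide.eventually hK.isClosed hzK)
    exact hz.2 (SameSide.trans hw' hw.symm)
  let F : ℂ → ℂ := U.piecewise (fun z => Complex.exp (G z) * (z - q)) (fun z => z - p)
  have hF : Continuous F := by
    refine Continuous.piecewise (fun z hz => ?_) (by fun_prop) (by fun_prop)
    rw [hGK z (hfr hz), hgK z (hfr hz)]
  have hF0 : ∀ z, F z ≠ 0 := by
    intro z
    by_cases hz : z ∈ U
    · simp only [F, piecewise_eq_of_mem _ _ _ hz]
      refine mul_ne_zero (Complex.exp_ne_zero _) (sub_ne_zero.2 ?_)
      rintro rfl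
      exact hq hz
    · simp only [F, piecewise_eq_of_notMem _ _ _ hz]
      refine sub_ne_zero.2 ?_
      rintro rfl
      exact hz (SameSide.refl hp)
  obtain ⟨h, hh, hexp⟩ := exists_log_of_continuous F hF hF0
  obtain ⟨R, hR⟩ := hb.subset_closedBall p
  refine no_log_on_circle h hh p (max R 0 + 1) (by positivity) fun z hz => ?_
  have hzU : z ∉ U := by
    intro hzU
    have := hR hzU
    rw [Metric.mem_closedBall, dist_eq_norm, hz] at this
    linarith [le_max_left R 0]
  rw [hexp, show F z = z - p from piecewise_eq_of_notMem _ _ _ hzU]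

/-- **Eilenberg's criterion**. -/
theorem HasLog.sameSide {K : Set ℂ} {p q : ℂ} (hK : IsCompact K) (hp : p ∉ K) (hq : q ∉ K)
    (h : HasLog K p q) : SameSide K p q := by
  by_contra hn
  have hbp : ¬ Bornology.IsBounded {z | SameSide K p z} := fun hb =>
    hn (h.sameSide_of_bounded hK hp hb)
  have hbq : ¬ Bornology.IsBounded {z | SameSide K q z} := fun hb =>
    hn (h.symm.sameSide_of_bounded hK hq hb).symm
  obtain ⟨R, hR⟩ := hK.isBounded.subset_closedBall 0
  have hext : ∀ {p : ℂ}, ¬ Bornology.IsBounded {z | SameSide K p z} →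
      ∃ z, R < ‖z‖ ∧ SameSide K p z := by
    intro p hb
    by_contra! hall
    refine hb ((Metric.isBounded_closedBall (x := (0 : ℂ)) (r := R)).subset fun z hz => ?_)
    by_contra hz'
    exact hall z (by simpa using hz') hz
  obtain ⟨z, hz, hpz⟩ := hext hbp
  obtain ⟨w, hw, hqw⟩ := hext hbq
  have hcon : IsPreconnected (Metric.closedBall (0 : ℂ) R)ᶜ := by
    have himg : (Metric.closedBall (0 : ℂ) R)ᶜ =
        (fun x : ℝ × ℝ => (x.1 : ℂ) * Complex.exp (x.2 * Complex.I)) '' (Ioi R ×ˢ univ) := by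
      ext z
      simp only [mem_compl_iff, Metric.mem_closedBall, dist_zero_right, not_le, mem_image,
        mem_prod, mem_Ioi, mem_univ, and_true]
      constructor
      · intro hz
        exact ⟨(‖z‖, z.arg), hz, Complex.norm_mul_exp_arg_mul_I z⟩
      · rintro ⟨x, hx, rfl⟩
        simpa [Complex.norm_exp_ofReal_mul_I] using hx.trans_le (le_abs_self _)
    rw [himg]
    exact (isPreconnected_Ioi.prod isPreconnected_univ).image _ (by fun_prop)
  refine hn (hpz.trans (SameSide.trans ⟨_, hcon, compl_subset_compl.2 hR, ?_, ?_⟩ hqw.symm))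
  · simpa using hz
  · simpa using hw

/-- **Janiszewski's theorem** in the complex plane. -/
theorem janiszewski_complex {K L : Set ℂ} {p q : ℂ} (hK : IsCompact K) (hL : IsCompact L)
    (hKL : IsPreconnected (K ∩ L)) (h : SameSide K p q) (h' : SameSide L p q) :
    SameSide (K ∪ L) p q := by
  classical
  have hpK := h.left_notMem
  have hqK := h.right_notMem
  refine HasLog.sameSide (hK.union hL) (fun hp => hp.elim hpK h'.left_notMem)
    (fun hq => hq.elim hqK h'.right_notMem) ?_
  obtain ⟨g, hg, hgK⟩ := HasLog.of_sameSide hK.isClosed h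
  obtain ⟨k, hk, hkL⟩ := HasLog.of_sameSide hL.isClosed h'
  have hd : ∃ c : ℂ, Complex.exp c = 1 ∧ ∀ z ∈ K ∩ L, g z = k z + c := by
    have h1 : ∀ z ∈ K ∩ L, Complex.exp (g z - k z) = 1 := by
      intro z hz
      have hzq : z - q ≠ 0 := sub_ne_zero.2 (by rintro rfl; exact hqK hz.1)
      rw [Complex.exp_sub, div_eq_one_iff_eq (Complex.exp_ne_zero _)]
      exact mul_right_cancel₀ hzq ((hgK z hz.1).trans (hkL z hz.2).symm)
    rcases (K ∩ L).eq_empty_or_nonempty with he | ⟨z₀, hz₀⟩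
    · exact ⟨0, by simp, by simp [he]⟩
    · refine ⟨g z₀ - k z₀, h1 z₀ hz₀, fun z hz => ?_⟩
      have := eq_of_exp_eq_one hKL (d := fun z => g z - k z)
        ((hg.mono inter_subset_left).sub (hk.mono inter_subset_right)) h1 hz hz₀
      rw [← this]
      ring
  obtain ⟨c, hc, hcz⟩ := hd
  have hL' : EqOn (K.piecewise g fun z => k z + c) (fun z => k z + c) L := by
    intro z hz
    by_cases hzK : z ∈ K
    · rw [piecewise_eq_of_mem _ _ _ hzK, hcz z ⟨hzK, hz⟩]
    · rw [piecewise_eq_of_notMem _ _ _ hzK]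
  refine ⟨K.piecewise g fun z => k z + c, ?_, ?_⟩
  · exact ((hg.congr (piecewise_eqOn K _ _)).union_of_isClosed
      ((hk.add continuousOn_const).congr hL') hK.isClosed hL.isClosed)
  · rintro z (hz | hz)
    · rw [piecewise_eq_of_mem _ _ _ hz, hgK z hz]
    · rw [hL' hz, Complex.exp_add, hc, mul_one, hkL z hz]

/-- An arc does not separate the complex plane. -/
theorem arc_sameSide_complex {f : ℝ → ℂ} {a b : ℝ} (hab : a ≤ b) (hf : ContinuousOn f (Icc a b))
    (hinj : InjOn f (Icc a b)) {p q : ℂ} (hp : p ∉ f '' Icc a b) (hq : q ∉ f '' Icc a b) :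
    SameSide (f '' Icc a b) p q := by
  have hcomp : IsCompact (f '' Icc a b) := isCompact_Icc.image_of_continuousOn hf
  refine HasLog.sameSide hcomp hp hq ?_
  set e : ℝ → ℂ := IccExtend hab (domRestrict (Icc a b) f) with he
  have hec : Continuous e := (continuousOn_iff_continuous_domRestrict.1 hf).Icc_extend'
  have hmem : ∀ t, e t ∈ f '' Icc a b := fun t => ⟨_, (projIcc a b hab t).2, rfl⟩
  have hef : ∀ t ∈ Icc a b, e t = f t := fun t ht => IccExtend_of_mem hab _ ht
  have hne : ∀ {r}, r ∉ f '' Icc a b → ∀ t, e t - r ≠ 0 := by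
    intro r hr t
    refine sub_ne_zero.2 ?_
    rintro rfl
    exact hr (hmem t)
  obtain ⟨h, hh, hexp⟩ := exists_log_of_continuous (fun t => (e t - p) / (e t - q))
    ((hec.sub continuous_const).div (hec.sub continuous_const) (hne hq))
    fun t => div_ne_zero (hne hp t) (hne hq t)
  refine ⟨h ∘ Function.invFunOn f (Icc a b), ?_, ?_⟩
  · refine hh.comp_continuousOn ?_
    rw [continuousOn_iff_isClosed]
    intro t ht
    refine ⟨f '' (t ∩ Icc a b), ((isCompact_Icc.inter_left ht).image_of_continuousOn
      (hf.mono inter_subset_right)).isClosed, ?_⟩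
    ext z
    constructor
    · rintro ⟨hz, x, hx, rfl⟩
      rw [mem_preimage, hinj.leftInvOn_invFunOn hx] at hz
      exact ⟨⟨x, ⟨hz, hx⟩, rfl⟩, x, hx, rfl⟩
    · rintro ⟨⟨x, ⟨hxt, hx⟩, rfl⟩, h⟩
      refine ⟨?_, h⟩
      rwa [mem_preimage, hinj.leftInvOn_invFunOn hx]
  · rintro _ ⟨t, ht, rfl⟩
    simp only [Function.comp]
    rw [hinj.leftInvOn_invFunOn ht, hexp, hef t ht, div_mul_cancel₀]
    rw [← hef t ht]
    exact hne hq t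

/-- **Janiszewski's theorem**. -/
theorem janiszewski {K L : Set (ℝ × ℝ)} {p q : ℝ × ℝ} (hK : IsCompact K) (hL : IsCompact L)
    (hKL : IsPreconnected (K ∩ L)) (h : SameSide K p q) (h' : SameSide L p q) :
    SameSide (K ∪ L) p q := by
  let e : ℝ × ℝ ≃ₜ ℂ := Complex.equivRealProdCLM.symm.toHomeomorph
  have := janiszewski_complex (hK.image e.continuous) (hL.image e.continuous)
    (by rw [← image_inter e.injective]; exact hKL.image _ e.continuous.continuousOn)
    (h.image e) (h'.image e)
  rw [← image_union] at this
  simpa [← image_comp] using this.image e.symm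

/-- An arc does not separate the plane. -/
theorem arc_sameSide {f : ℝ → ℝ × ℝ} {a b : ℝ} (hab : a ≤ b) (hf : ContinuousOn f (Icc a b))
    (hinj : InjOn f (Icc a b)) {p q : ℝ × ℝ} (hp : p ∉ f '' Icc a b) (hq : q ∉ f '' Icc a b) :
    SameSide (f '' Icc a b) p q := by
  let e : ℝ × ℝ ≃ₜ ℂ := Complex.equivRealProdCLM.symm.toHomeomorph
  have hi : ∀ x, x ∉ f '' Icc a b → e x ∉ (e ∘ f) '' Icc a b := by
    rw [image_comp]
    intro x hx hx'
    exact hx (e.injective.mem_set_image.1 hx')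
  have := arc_sameSide_complex hab (e.continuous.comp_continuousOn hf)
    (e.injective.comp_injOn hinj) (hi p hp) (hi q hq)
  rw [image_comp] at this
  simpa [← image_comp] using this.image e.symm

theorem SameSide.exists_isCompact {K : Set (ℝ × ℝ)} (hK : IsClosed K) {p q : ℝ × ℝ}
    (h : SameSide K p q) :
    ∃ γ : Set (ℝ × ℝ), IsCompact γ ∧ IsPreconnected γ ∧ γ ⊆ Kᶜ ∧ p ∈ γ ∧ q ∈ γ := by
  have hp : p ∈ Kᶜ := h.left_notMem
  have hc : IsPathConnected (connectedComponentIn Kᶜ p) :=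
    (hK.isOpen_compl.connectedComponentIn).isConnected_iff_isPathConnected.1
      (isConnected_connectedComponentIn_iff.2 hp)
  obtain ⟨γ, hγ⟩ := hc.joinedIn p (mem_connectedComponentIn hp) q
    (SameSide.iff_mem_connectedComponentIn.1 h)
  refine ⟨range γ, isCompact_range γ.continuous, isPreconnected_range γ.continuous, ?_,
    ⟨0, γ.source⟩, ⟨1, γ.target⟩⟩
  rintro _ ⟨t, rfl⟩
  exact connectedComponentIn_subset _ _ (hγ t)

theorem SameSide.of_mem_ball {K : Set (ℝ × ℝ)} (hK : IsClosed K) {x : ℝ × ℝ} (hx : x ∉ K) :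
    ∃ V ∈ nhds x, ∀ z ∈ V, ∀ w ∈ V, SameSide K z w := by
  obtain ⟨ε, hε, hball⟩ := Metric.isOpen_iff.1 hK.isOpen_compl x hx
  exact ⟨_, Metric.ball_mem_nhds x hε, fun z hz w hw =>
    ⟨_, (convex_ball x ε).isPreconnected, hball, hz, hw⟩⟩

/-- If two branches `A₁`, `A₂` at `x` of a closed curve end on the same side of a closed curve `C`
through `x`, then near `x` the curve `C` stays on one side of the first curve. -/
theorem exists_nhds_sameSide_of_sameSide {C A₁ A₂ L : Set (ℝ × ℝ)} {x p₁ p₂ : ℝ × ℝ}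
    (hC : IsClosed C) (hxC : x ∈ C) (hCx : IsPreconnected (C \ {x}))
    (hA₁ : IsCompact A₁) (hA₂ : IsCompact A₂) (hL : IsCompact L)
    (hA₁C : A₁ ∩ C ⊆ {x}) (hA₂C : A₂ ∩ C ⊆ {x}) (hA₁L : A₁ ∩ L ⊆ {p₁}) (hA₂L : A₂ ∩ L ⊆ {p₂})
    (hxL : x ∉ L) (h : SameSide C p₁ p₂) :
    ∃ V ∈ nhds x, ∀ z ∈ C ∩ V, z ≠ x → ∀ w ∈ C ∩ V, w ≠ x → SameSide (A₁ ∪ A₂ ∪ L) z w := by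
  obtain ⟨γ, hγc, hγp, hγC, h1, h2⟩ := h.exists_isCompact hC
  have hx : x ∉ L ∪ γ := fun hx => hx.elim hxL fun hx => hγC hx hxC
  obtain ⟨V, hV, hVs⟩ := SameSide.of_mem_ball (hL.union hγc).isClosed hx
  refine ⟨V, hV, fun z hz hzx w hw hwx => ?_⟩
  refine SameSide.mono (K := (A₁ ∪ A₂ ∪ γ) ∪ (L ∪ γ)) (janiszewski ((hA₁.union hA₂).union hγc)
    (hL.union hγc) ?_ ⟨C \ {x}, hCx, ?_, ⟨hz.1, hzx⟩, ⟨hw.1, hwx⟩⟩ (hVs z hz.2 w hw.2)) ?_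
  · have : (A₁ ∪ A₂ ∪ γ) ∩ (L ∪ γ) = γ := by
      apply Subset.antisymm
      · rintro v ⟨(hv | hv) | hv, hv' | hv'⟩
        · rw [show v = p₁ from hA₁L ⟨hv, hv'⟩]; exact h1
        · exact hv'
        · rw [show v = p₂ from hA₂L ⟨hv, hv'⟩]; exact h2
        all_goals first | exact hv' | exact hv
      · exact fun v hv => ⟨Or.inr hv, Or.inr hv⟩
    rwa [this]
  · rintro v ⟨hv, hvx⟩ ((hv' | hv') | hv')
    · exact hvx (hA₁C ⟨hv', hv⟩)
    · exact hvx (hA₂C ⟨hv', hv⟩)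
    · exact hγC hv' hv
  · rintro v ((hv | hv) | hv)
    · exact Or.inl (Or.inl (Or.inl hv))
    · exact Or.inl (Or.inl (Or.inr hv))
    · exact Or.inr (Or.inl hv)

theorem IsPreconnected.exists_notMem_of_finite {I F V : Set ℝ} (hI : IsPreconnected I)
    (hI' : I.Nontrivial) (hF : F.Finite) {t : ℝ} (ht : t ∈ I) (hV : V ∈ nhdsWithin t I) :
    ∃ v ∈ V, v ∈ I ∧ v ∉ F := by
  have hacc : (nhdsWithin t {t}ᶜ ⊓ Filter.principal I).NeBot :=
    hI.preperfect_of_nontrivial hI' t ht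
  have hV' : ∀ᶠ v in nhdsWithin t {t}ᶜ ⊓ Filter.principal I, v ∈ V :=
    (inf_le_inf_right _ inf_le_left :
      nhdsWithin t {t}ᶜ ⊓ Filter.principal I ≤ nhdsWithin t I) hV
  have h1 : ∀ᶠ v in nhds t, v ∉ F \ {t} :=
    (hF.subset sdiff_subset).isClosed.isOpen_compl.mem_nhds (by simp)
  have h2 : ∀ᶠ v in nhdsWithin t {t}ᶜ, v ≠ t := self_mem_nhdsWithin
  have hF' : ∀ᶠ v in nhdsWithin t {t}ᶜ ⊓ Filter.principal I, v ∈ I ∧ v ∉ F := by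
    filter_upwards [Filter.mem_inf_of_left (Filter.Eventually.filter_mono nhdsWithin_le_nhds h1),
      Filter.mem_inf_of_left h2, Filter.mem_inf_of_right (Filter.mem_principal_self I)]
      with v hv1 hv2 hv3
    exact ⟨hv3, fun hF => hv1 ⟨hF, hv2⟩⟩
  exact (hV'.and hF').exists

/-- A curve meeting `K` finitely often and locally staying on one side of `K` at each meeting
point stays on one side of `K`. -/
theorem sameSide_of_locally {K : Set (ℝ × ℝ)} (hK : IsClosed K) {f : ℝ → ℝ × ℝ} {I : Set ℝ}
    (hI : IsPreconnected I) (hf : ContinuousOn f I) (hfin : {t ∈ I | f t ∈ K}.Finite)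
    (hloc : ∀ t ∈ I, f t ∈ K → ∃ V ∈ nhdsWithin t I,
      ∀ s ∈ V, f s ∉ K → ∀ r ∈ V, f r ∉ K → SameSide K (f s) (f r))
    {s r : ℝ} (hs : s ∈ I) (hsK : f s ∉ K) (hr : r ∈ I) (hrK : f r ∉ K) :
    SameSide K (f s) (f r) := by
  rcases eq_or_ne s r with rfl | hne
  · exact SameSide.refl hsK
  have hloc' : ∀ t ∈ I, ∃ V ∈ nhdsWithin t I,
      ∀ s ∈ V, f s ∉ K → ∀ r ∈ V, f r ∉ K → SameSide K (f s) (f r) := by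
    intro t ht
    by_cases htK : f t ∈ K
    · exact hloc t ht htK
    · obtain ⟨W, hW, hWs⟩ := SameSide.of_mem_ball hK htK
      exact ⟨f ⁻¹' W, hf t ht hW, fun s hs _ r hr _ => hWs _ hs _ hr⟩
  have hdense : ∀ t ∈ I, ∀ V ∈ nhdsWithin t I, ∃ v ∈ V, f v ∉ K := by
    intro t ht V hV
    obtain ⟨v, hv, hvI, hvF⟩ := hI.exists_notMem_of_finite ⟨s, hs, r, hr, hne⟩ hfin ht hV
    exact ⟨v, hv, fun h => hvF ⟨hvI, h⟩⟩
  have key := hI.induction₂ (fun s r => ∃ V ∈ nhdsWithin s I, ∃ W ∈ nhdsWithin r I,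
      ∀ s ∈ V, f s ∉ K → ∀ r ∈ W, f r ∉ K → SameSide K (f s) (f r)) ?_ ?_ ?_ hs hr
  · obtain ⟨V, hV, W, hW, h⟩ := key
    exact h s (mem_of_mem_nhdsWithin hs hV) hsK r (mem_of_mem_nhdsWithin hr hW) hrK
  · intro t ht
    obtain ⟨V, hV, h⟩ := hloc' t ht
    filter_upwards [eventually_eventually_nhdsWithin.2 hV] with v hv
    exact ⟨V, hV, V, hv, h⟩
  · rintro x y z _ hy _ ⟨V, hV, W, hW, h⟩ ⟨V', hV', W', hW', h'⟩
    obtain ⟨v, hv, hvK⟩ := hdense y hy _ (Filter.inter_mem hW hV')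
    exact ⟨V, hV, W', hW', fun s hs hsK r hr hrK =>
      (h s hs hsK v hv.1 hvK).trans (h' v hv.2 hvK r hr hrK)⟩
  · rintro x y _ _ ⟨V, hV, W, hW, h⟩
    exact ⟨W, hW, V, hV, fun s hs hsK r hr hrK => (h r hr hrK s hs hsK).symm⟩

theorem isOpen_setOf_sameSide {K : Set (ℝ × ℝ)} (hK : IsClosed K) (p : ℝ × ℝ) :
    IsOpen {z | SameSide K p z} := by
  rw [isOpen_iff_mem_nhds]
  intro z hz
  filter_upwards [SameSide.eventually hK hz.right_notMem] with w hw
  exact SameSide.trans hz hw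

theorem isPreconnected_setOf_sameSide {X : Type*} [TopologicalSpace X] {K : Set X} (p : X) :
    IsPreconnected {z | SameSide K p z} := by
  have : {z | SameSide K p z} = connectedComponentIn Kᶜ p := by
    ext z
    exact SameSide.iff_mem_connectedComponentIn
  rw [this]
  exact isPreconnected_connectedComponentIn

/-- Every component of the complement of `T` accumulates at the part of `T` outside a
non-separating closed subset. -/
theorem exists_mem_closure_component {T α : Set (ℝ × ℝ)} (hT : IsClosed T)
    (hα : ∀ p q, p ∉ α → q ∉ α → SameSide α p q) (hαT : α ⊆ T) (hne : (T \ α).Nonempty)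
    {q : ℝ × ℝ} (hq : q ∉ T) : ∃ z ∈ T \ α, z ∈ closure {z | SameSide T q z} := by
  by_contra! h
  obtain ⟨w, hwT, hwα⟩ := hne
  obtain ⟨S, hS, hSα, hqS, hwS⟩ := hα q w (fun h => hq (hαT h)) hwα
  have := hS.subset_of_closure_inter_subset (isOpen_setOf_sameSide hT q)
    ⟨q, hqS, SameSide.refl hq⟩ (fun z hz => ?_) hwS
  · exact this.right_notMem hwT
  · have hzT : z ∉ T := fun hzT => h z ⟨hzT, hSα hz.2⟩ hz.1
    obtain ⟨v, hv, hv'⟩ := mem_closure_iff_nhds.1 hz.1 _ (SameSide.eventually hT hzT)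
    exact SameSide.trans hv' (SameSide.symm hv)

/-- A crosscut `L` in one component of the complement of the closed curve `α ∪ β` shows that there
is at most one further component. -/
theorem sameSide_of_crosscut {α β L : Set (ℝ × ℝ)} (hα : IsCompact α) (hβ : IsCompact β)
    (hL : IsCompact L) (hLp : IsPreconnected L) (hαβ : α ∩ β ⊆ L)
    (hα' : ∀ p q, p ∉ α → q ∉ α → SameSide α p q) (hβ' : ∀ p q, p ∉ β → q ∉ β → SameSide β p q)
    (hαp : IsPreconnected ((α ∪ β) \ β)) (hβp : IsPreconnected ((α ∪ β) \ α))
    (hαn : ((α ∪ β) \ β).Nonempty) (hβn : ((α ∪ β) \ α).Nonempty)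
    (hLT : L ∩ (α ∪ β) ⊆ α ∩ β) {p q r : ℝ × ℝ} (hp : ∀ l ∈ L, l ∉ α ∪ β → SameSide (α ∪ β) p l)
    (hq : q ∉ α ∪ β) (hr : r ∉ α ∪ β) (hpq : ¬ SameSide (α ∪ β) p q)
    (hpr : ¬ SameSide (α ∪ β) p r) : SameSide (α ∪ β) q r := by
  have hT : IsClosed (α ∪ β) := (hα.union hβ).isClosed
  have main : ∀ γ ⊆ α ∪ β, α ∩ β ⊆ γ → (∀ p q, p ∉ γ → q ∉ γ → SameSide γ p q) →
      IsPreconnected ((α ∪ β) \ γ) → ((α ∪ β) \ γ).Nonempty → SameSide (γ ∪ L) q r := by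
    intro γ hγ hγ' hsep hpre hne
    have half : ∀ q, q ∉ α ∪ β → ¬ SameSide (α ∪ β) p q →
        ∃ z ∈ (α ∪ β) \ γ, SameSide (γ ∪ L) q z := by
      intro q hq hpq
      obtain ⟨z, hz, hzc⟩ := exists_mem_closure_component hT hsep hγ hne hq
      refine ⟨z, hz, insert z {z | SameSide (α ∪ β) q z},
        (isPreconnected_setOf_sameSide q).subset_closure (subset_insert _ _)
          (insert_subset hzc subset_closure), ?_, Or.inr (SameSide.refl hq), Or.inl rfl⟩
      rintro v (rfl | hv) (hv' | hv')
      · exact hz.2 hv'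
      · exact hz.2 (hγ' (hLT ⟨hv', hz.1⟩))
      · exact hv.right_notMem (hγ hv')
      · exact hpq ((hp v hv' hv.right_notMem).trans hv.symm)
    obtain ⟨z, hz, hqz⟩ := half q hq hpq
    obtain ⟨w, hw, hrw⟩ := half r hr hpr
    refine (hqz.trans ⟨_, hpre, ?_, hz, hw⟩).trans hrw.symm
    rintro v hv (hv' | hv')
    · exact hv.2 hv'
    · exact hv.2 (hγ' (hLT ⟨hv', hv.1⟩))
  refine SameSide.mono (janiszewski (hα.union hL) (hβ.union hL) ?_
    (main α subset_union_left inter_subset_left hα' hβp hβn)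
    (main β subset_union_right inter_subset_right hβ' hαp hαn))
    (union_subset_union subset_union_left subset_union_left)
  rwa [← inter_union_distrib_right, union_eq_right.2 hαβ]

/-- The initial part of the path `f` lies on the same side of `K` as `p`. -/
def GermSide (K : Set (ℝ × ℝ)) (f : ℝ → ℝ × ℝ) (p : ℝ × ℝ) : Prop :=
  ∀ᶠ t in nhdsWithin 0 (Ioi (0 : ℝ)), SameSide K (f t) p

namespace GermSide

variable {K : Set (ℝ × ℝ)} {f : ℝ → ℝ × ℝ} {p q : ℝ × ℝ}

theorem trans (h : GermSide K f p) (h' : SameSide K p q) : GermSide K f q :=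
  h.mono fun _ ht => SameSide.trans ht h'

theorem unique (h : GermSide K f p) (h' : GermSide K f q) : SameSide K p q := by
  obtain ⟨t, ht, ht'⟩ := (Filter.Eventually.and h h').exists
  exact ht.symm.trans ht'

theorem of_subset {s : Set ℝ} (hs : s.OrdConnected) (hf : ContinuousOn f s)
    {ε : ℝ} (hε : 0 < ε) (hεs : Ioo 0 ε ⊆ s) (hK : ∀ t ∈ s, f t ∉ K) {t : ℝ} (ht : t ∈ s) :
    GermSide K f (f t) := by
  filter_upwards [Ioo_mem_nhdsGT hε] with r hr
  exact ⟨f '' s, hs.isPreconnected.image f hf, by rintro _ ⟨x, hx, rfl⟩; exact hK x hx,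
    ⟨r, hεs hr, rfl⟩, ⟨t, ht, rfl⟩⟩

end GermSide

namespace SimpleDrawing

variable {n : ℕ} {D : SimpleDrawing n} {i j k l : Fin n} {p : ℝ × ℝ}

/-- `f` parametrizes the arc of `D` from the vertex `i` to the vertex `j`. -/
structure IsArcParam (D : SimpleDrawing n) (i j : Fin n) (f : ℝ → ℝ × ℝ) : Prop where
  continuousOn : ContinuousOn f (Icc 0 1)
  injOn : InjOn f (Icc 0 1)
  image_eq : f '' Icc 0 1 = D.arc i j
  map_zero : f 0 = D.vert i
  map_one : f 1 = D.vert j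

theorem exists_isArcParam (h : i ≠ j) : ∃ f, D.IsArcParam i j f :=
  let ⟨f, h1, h2, h3, h4, h5⟩ := D.arc_simple i j h
  ⟨f, h1, h2, h3, h4, h5⟩

namespace IsArcParam

variable {f : ℝ → ℝ × ℝ} {s t : ℝ}

theorem mem (hf : D.IsArcParam i j f) (ht : t ∈ Icc (0 : ℝ) 1) : f t ∈ D.arc i j :=
  hf.image_eq ▸ mem_image_of_mem f ht

theorem image_subset (hf : D.IsArcParam i j f) {I : Set ℝ} (hI : I ⊆ Icc 0 1) :
    f '' I ⊆ D.arc i j := hf.image_eq ▸ image_mono hI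

theorem exists_eq (hf : D.IsArcParam i j f) (hp : p ∈ D.arc i j) :
    ∃ t ∈ Icc (0 : ℝ) 1, f t = p := by rwa [← hf.image_eq] at hp

theorem eq_zero (hf : D.IsArcParam i j f) (ht : t ∈ Icc (0 : ℝ) 1) (h : f t = D.vert i) :
    t = 0 := hf.injOn ht (by simp) (h.trans hf.map_zero.symm)

theorem eq_one (hf : D.IsArcParam i j f) (ht : t ∈ Icc (0 : ℝ) 1) (h : f t = D.vert j) :
    t = 1 := hf.injOn ht (by simp) (h.trans hf.map_one.symm)

theorem isCompact_image (hf : D.IsArcParam i j f) (hs : 0 ≤ s) (ht : t ≤ 1) :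
    IsCompact (f '' Icc s t) :=
  isCompact_Icc.image_of_continuousOn (hf.continuousOn.mono (Icc_subset_Icc hs ht))

theorem isPreconnected_image (hf : D.IsArcParam i j f) {I : Set ℝ} (hI : I.OrdConnected)
    (hI' : I ⊆ Icc 0 1) : IsPreconnected (f '' I) :=
  hI.isPreconnected.image f (hf.continuousOn.mono hI')

theorem sameSide_image (hf : D.IsArcParam i j f) (hs : 0 ≤ s) (hst : s ≤ t) (ht : t ≤ 1)
    {p q : ℝ × ℝ} (hp : p ∉ f '' Icc s t) (hq : q ∉ f '' Icc s t) :
    SameSide (f '' Icc s t) p q :=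
  arc_sameSide hst (hf.continuousOn.mono (Icc_subset_Icc hs ht))
    (hf.injOn.mono (Icc_subset_Icc hs ht)) hp hq

theorem finite_hits (hf : D.IsArcParam i j f) {K : Set (ℝ × ℝ)} (h : (D.arc i j ∩ K).Finite) :
    {t ∈ Icc (0 : ℝ) 1 | f t ∈ K}.Finite := by
  refine Finite.of_finite_image (h.subset ?_) (hf.injOn.mono fun t ht => ht.1)
  rintro _ ⟨t, ht, rfl⟩
  exact ⟨hf.mem ht.1, ht.2⟩

theorem tendsto_zero (hf : D.IsArcParam i j f) :
    Filter.Tendsto f (nhdsWithin 0 (Ioi 0)) (nhds (D.vert i)) := by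
  rw [← hf.map_zero]
  exact (hf.continuousOn 0 (by simp)).mono_left
    (nhdsWithin_le_of_mem (Filter.mem_of_superset (Ioc_mem_nhdsGT one_pos) Ioc_subset_Icc_self))

theorem eventually_mem (hf : D.IsArcParam i j f) :
    ∀ᶠ t in nhdsWithin 0 (Ioi (0 : ℝ)), f t ∈ D.arc i j ∧ f t ≠ D.vert i := by
  filter_upwards [Ioc_mem_nhdsGT (one_pos : (0 : ℝ) < 1)] with t ht
  exact ⟨hf.mem (Ioc_subset_Icc_self ht), fun h => ht.1.ne' (hf.eq_zero (Ioc_subset_Icc_self ht) h)⟩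

theorem germSide (hf : D.IsArcParam i j f) {K : Set (ℝ × ℝ)} {I : Set ℝ} (hI : I.OrdConnected)
    {ε : ℝ} (hε : 0 < ε) (hεI : Ioo 0 ε ⊆ I) (hI' : I ⊆ Icc 0 1) (hK : ∀ t ∈ I, f t ∉ K)
    (ht : t ∈ I) : GermSide K f (f t) :=
  GermSide.of_subset hI (hf.continuousOn.mono hI') hε hεI hK ht

theorem germSide_vert (hf : D.IsArcParam i j f) {K : Set (ℝ × ℝ)}
    (hK : D.arc i j ∩ K ⊆ {D.vert i}) : GermSide K f (D.vert j) := by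
  rw [← hf.map_one]
  refine hf.germSide ordConnected_Ioc one_pos Ioo_subset_Ioc_self Ioc_subset_Icc_self
    (fun t ht htK => ?_) ⟨one_pos, le_rfl⟩
  exact ht.1.ne' (hf.eq_zero (Ioc_subset_Icc_self ht) (hK ⟨hf.mem (Ioc_subset_Icc_self ht), htK⟩))

theorem exists_germSide (hf : D.IsArcParam i j f) {K : Set (ℝ × ℝ)} (h : (D.arc i j ∩ K).Finite) :
    ∃ p, GermSide K f p := by
  have h1 : ∀ᶠ t in nhds (0 : ℝ), t ∉ {t ∈ Icc (0 : ℝ) 1 | f t ∈ K} \ {0} :=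
    ((hf.finite_hits h).subset sdiff_subset).isClosed.isOpen_compl.mem_nhds (by simp)
  obtain ⟨δ, hδ, hδ'⟩ := mem_nhdsGT_iff_exists_Ioo_subset.1
    ((h1.filter_mono nhdsWithin_le_nhds).and (Ioc_mem_nhdsGT (one_pos : (0 : ℝ) < 1)))
  refine ⟨_, hf.germSide ordConnected_Ioo hδ subset_rfl
    (fun t ht => Ioc_subset_Icc_self (hδ' ht).2) (fun t ht htK => ?_)
    (t := δ / 2) ⟨half_pos hδ, half_lt_self hδ⟩⟩
  exact (hδ' ht).1 ⟨⟨Ioc_subset_Icc_self (hδ' ht).2, htK⟩, ht.1.ne'⟩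

end IsArcParam

theorem vert_left_mem (h : i ≠ j) : D.vert i ∈ D.arc i j := by
  obtain ⟨f, hf⟩ := exists_isArcParam (D := D) h
  exact hf.map_zero ▸ hf.mem (by simp)

theorem vert_right_mem (h : i ≠ j) : D.vert j ∈ D.arc i j :=
  D.arc_symm i j ▸ vert_left_mem h.symm

theorem vert_notMem_arc (h : i ≠ j) (hi : k ≠ i) (hj : k ≠ j) : D.vert k ∉ D.arc i j :=
  fun hk => (D.no_through_vertex i j k h hk).elim hi hj

theorem isCompact_arc (h : i ≠ j) : IsCompact (D.arc i j) := by
  obtain ⟨f, hf⟩ := exists_isArcParam (D := D) h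
  exact hf.image_eq ▸ hf.isCompact_image le_rfl le_rfl

theorem isPreconnected_arc (h : i ≠ j) : IsPreconnected (D.arc i j) := by
  obtain ⟨f, hf⟩ := exists_isArcParam (D := D) h
  exact hf.image_eq ▸ hf.isPreconnected_image ordConnected_Icc subset_rfl

theorem isPreconnected_arc_sdiff (h : i ≠ j) : IsPreconnected (D.arc i j \ {D.vert i}) := by
  obtain ⟨f, hf⟩ := exists_isArcParam (D := D) h
  have : D.arc i j \ {D.vert i} = f '' Ioc 0 1 := by
    rw [← hf.image_eq, ← hf.map_zero]
    ext z
    constructor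
    · rintro ⟨⟨t, ht, rfl⟩, hz⟩
      exact ⟨t, ⟨ht.1.lt_of_ne fun h => hz (h ▸ rfl), ht.2⟩, rfl⟩
    · rintro ⟨t, ht, rfl⟩
      exact ⟨⟨t, Ioc_subset_Icc_self ht, rfl⟩,
        fun h => ht.1.ne' (hf.injOn (Ioc_subset_Icc_self ht) (by simp) h)⟩
  rw [this]
  exact hf.isPreconnected_image ordConnected_Ioc Ioc_subset_Icc_self

theorem eq_vert_of_mem (hij : i ≠ j) (hik : i ≠ k) (hjk : j ≠ k) (h : p ∈ D.arc i j)
    (h' : p ∈ D.arc i k) : p = D.vert i :=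
  D.inter_subsingleton i j i k hij hik (by simp [hjk, hik]) ⟨h, h'⟩
    ⟨vert_left_mem hij, vert_left_mem hik⟩

theorem finite_arc_inter (hij : i ≠ j) (hkl : k ≠ l) (h : s(i, j) ≠ s(k, l)) :
    (D.arc i j ∩ D.arc k l).Finite :=
  (D.inter_subsingleton i j k l hij hkl h).finite

theorem isCompact_triangle (hij : i ≠ j) (hjk : j ≠ k) (hik : i ≠ k) :
    IsCompact (D.triangle i j k) :=
  ((isCompact_arc hij).union (isCompact_arc hjk)).union (isCompact_arc hik)

theorem triangle_comm (i j k : Fin n) : D.triangle i j k = D.triangle i k j := by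
  simp only [triangle, D.arc_symm k j]
  exact union_right_comm _ _ _ |>.trans (by ac_rfl)

theorem isPreconnected_triangle_sdiff_vert (hij : i ≠ j) (hjk : j ≠ k) (hik : i ≠ k) :
    IsPreconnected (D.triangle i j k \ {D.vert i}) := by
  have : D.triangle i j k \ {D.vert i} =
      (D.arc i j \ {D.vert i}) ∪ D.arc j k ∪ (D.arc i k \ {D.vert i}) := by
    rw [triangle, union_sdiff_distrib, union_sdiff_distrib,
      sdiff_singleton_eq_self (vert_notMem_arc hjk hij hik)]
  rw [this]
  have hj : D.vert j ∈ D.arc i j \ {D.vert i} := ⟨vert_right_mem hij, D.vert_inj.ne hij.symm⟩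
  have hk : D.vert k ∈ D.arc i k \ {D.vert i} := ⟨vert_right_mem hik, D.vert_inj.ne hik.symm⟩
  exact ((isPreconnected_arc_sdiff hij).union (D.vert j) hj (vert_left_mem hjk)
    (isPreconnected_arc hjk)).union (D.vert k) (Or.inr (vert_right_mem hjk)) hk
    (isPreconnected_arc_sdiff hik)

theorem isPreconnected_triangle_sdiff (hij : i ≠ j) (hjk : j ≠ k) (hik : i ≠ k)
    {g : ℝ → ℝ × ℝ} (hg : D.IsArcParam j k g) {τ : ℝ} (hτ : τ ∈ Ioo (0 : ℝ) 1) :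
    IsPreconnected (D.triangle i j k \ {g τ}) := by
  have hτ' := Ioo_subset_Icc_self hτ
  have h1 : g τ ∉ D.arc i j := fun h => hτ.1.ne' (hg.eq_zero hτ'
    (eq_vert_of_mem hjk hij.symm hik.symm (hg.mem hτ') (D.arc_symm i j ▸ h)))
  have h2 : g τ ∉ D.arc i k := fun h => hτ.2.ne (hg.eq_one hτ'
    (eq_vert_of_mem hjk.symm hik.symm hij.symm (D.arc_symm j k ▸ hg.mem hτ') (D.arc_symm i k ▸ h)))
  have : D.triangle i j k \ {g τ} =
      (D.arc i j ∪ g '' Ico 0 τ) ∪ (D.arc i k ∪ g '' Ioc τ 1) := by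
    rw [triangle, union_sdiff_distrib, union_sdiff_distrib, sdiff_singleton_eq_self h1,
      sdiff_singleton_eq_self h2]
    have : D.arc j k \ {g τ} = g '' Ico 0 τ ∪ g '' Ioc τ 1 := by
      rw [← hg.image_eq]
      ext z
      constructor
      · rintro ⟨⟨t, ht, rfl⟩, hz⟩
        rcases lt_trichotomy t τ with h | rfl | h
        · exact Or.inl ⟨t, ⟨ht.1, h⟩, rfl⟩
        · exact absurd rfl hz
        · exact Or.inr ⟨t, ⟨h, ht.2⟩, rfl⟩
      · rintro (⟨t, ht, rfl⟩ | ⟨t, ht, rfl⟩)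
        · have ht' : t ∈ Icc (0 : ℝ) 1 := ⟨ht.1, ht.2.le.trans hτ'.2⟩
          exact ⟨⟨t, ht', rfl⟩, fun h => ht.2.ne (hg.injOn ht' hτ' h)⟩
        · have ht' : t ∈ Icc (0 : ℝ) 1 := ⟨hτ'.1.trans ht.1.le, ht.2⟩
          exact ⟨⟨t, ht', rfl⟩, fun h => ht.1.ne' (hg.injOn ht' hτ' h)⟩
    rw [this]
    ac_rfl
  rw [this]
  have h0 : D.vert j ∈ g '' Ico 0 τ := ⟨0, ⟨le_rfl, hτ.1⟩, hg.map_zero⟩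
  have h1 : D.vert k ∈ g '' Ioc τ 1 := ⟨1, ⟨hτ.2, le_rfl⟩, hg.map_one⟩
  have h0' := hg.isPreconnected_image (I := Ico 0 τ) ordConnected_Ico
    fun t ht => ⟨ht.1, ht.2.le.trans hτ'.2⟩
  have h1' := hg.isPreconnected_image (I := Ioc τ 1) ordConnected_Ioc
    fun t ht => ⟨hτ'.1.trans ht.1.le, ht.2⟩
  exact ((isPreconnected_arc hij).union (D.vert j) (vert_right_mem hij) h0 h0').union (D.vert i)
    (Or.inl (vert_left_mem hij)) (Or.inl (vert_left_mem hik))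
    ((isPreconnected_arc hik).union (D.vert k) (vert_right_mem hik) h1 h1')

variable {o a b c d u y : Fin n} {fa fb fc fd fu fy g : ℝ → ℝ × ℝ}

theorem EmanatesInto.germSide {K : Set (ℝ × ℝ)}
    (h : D.EmanatesInto o b (connectedComponentIn Kᶜ p)) (hb : D.IsArcParam o b fb) :
    GermSide K fb p := by
  obtain ⟨U, hU, hUC⟩ := h
  filter_upwards [hb.eventually_mem, hb.tendsto_zero hU] with t ht htU
  exact (SameSide.iff_mem_connectedComponentIn.2 (hUC ⟨⟨ht.1, htU⟩, ht.2⟩)).symm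

theorem SeparatesAt.false_of_germSide (h : D.SeparatesAt o a c b d) (hb : D.IsArcParam o b fb)
    (hd : D.IsArcParam o d fd) (h1 : GermSide (D.triangle o a c) fb p)
    (h2 : GermSide (D.triangle o a c) fd p) : False := by
  obtain ⟨q, r, -, -, hne, hq, hr⟩ := h
  exact hne (connectedComponentIn_eq (SameSide.iff_mem_connectedComponentIn.1
    (((hq.germSide hb).unique h1).trans (h2.unique (hr.germSide hd)))))

/-- If at `o` the edges to `a` and `b` start on the same side of the triangle `o u y`, then the
edges to `u` and `y` start on the same side of the triangle `o a b`. -/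
theorem exists_germSide_of_germSide (ha : D.IsArcParam o a fa) (hb : D.IsArcParam o b fb)
    (hu : D.IsArcParam o u fu) (hy : D.IsArcParam o y fy) (hao : a ≠ o) (hbo : b ≠ o) (huo : u ≠ o)
    (hyo : y ≠ o) (hab : a ≠ b) (huy : u ≠ y)
    (h1 : GermSide (D.triangle o u y) fa p) (h2 : GermSide (D.triangle o u y) fb p) :
    ∃ q, GermSide (D.triangle o a b) fu q ∧ GermSide (D.triangle o a b) fy q := by
  have hbr : ∀ {e : Fin n} {fe : ℝ → ℝ × ℝ}, D.IsArcParam o e fe →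
      GermSide (D.triangle o u y) fe p → ∃ t ∈ Ioo (0 : ℝ) 1, SameSide (D.triangle o u y) (fe t) p ∧
        fe '' Icc 0 t ∩ D.triangle o u y ⊆ {D.vert o} := by
    intro e fe he h
    obtain ⟨δ, hδ, hδ'⟩ := mem_nhdsGT_iff_exists_Ioo_subset.1 h
    have ht : min δ 1 / 2 ∈ Ioo 0 (min δ 1) :=
      ⟨half_pos (lt_min hδ one_pos), half_lt_self (lt_min hδ one_pos)⟩
    refine ⟨min δ 1 / 2, ⟨ht.1, ht.2.trans_le (min_le_right _ _)⟩,
      hδ' ⟨ht.1, ht.2.trans_le (min_le_left _ _)⟩, ?_⟩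
    rintro _ ⟨⟨s, hs, rfl⟩, hsT⟩
    rcases hs.1.eq_or_lt with rfl | hs0
    · exact he.map_zero
    · exact absurd hsT (hδ' ⟨hs0, (hs.2.trans_lt ht.2).trans_le (min_le_left _ _)⟩).left_notMem
  obtain ⟨s, hs, hsp, hsT⟩ := hbr ha h1
  obtain ⟨t, ht, htp, htT⟩ := hbr hb h2
  have hdis : ∀ {e e' : Fin n} {fe fe' : ℝ → ℝ × ℝ}, D.IsArcParam o e fe → D.IsArcParam o e' fe' →
      e ≠ o → e' ≠ o → e ≠ e' → ∀ {s t : ℝ}, s ∈ Ioo (0 : ℝ) 1 → t ∈ Ioo (0 : ℝ) 1 →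
      ∀ z ∈ fe '' Icc 0 s, (z ∈ fe '' Icc s 1 ∨ z ∈ D.arc e e') ∨ z ∈ fe' '' Icc t 1 →
      z = fe s := by
    intro e e' fe fe' he he' heo heo' hee s t hs ht z hz hz'
    obtain ⟨r, hr, rfl⟩ := hz
    have hr' : r ∈ Icc (0 : ℝ) 1 := ⟨hr.1, hr.2.trans hs.2.le⟩
    rcases hz' with (⟨r', hr'', h⟩ | h) | ⟨r', hr'', h⟩
    · have := he.injOn ⟨hs.1.le.trans hr''.1, hr''.2⟩ hr' h
      rw [show r = s from le_antisymm hr.2 (this ▸ hr''.1)]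
    · have := he.eq_one hr' (eq_vert_of_mem heo hee heo'.symm (D.arc_symm o e ▸ he.mem hr') h)
      exact absurd hr.2 (this ▸ hs.2.not_ge)
    · have hr1 : r' ∈ Icc (0 : ℝ) 1 := ⟨ht.1.le.trans hr''.1, hr''.2⟩
      have := he'.eq_zero hr1 (eq_vert_of_mem heo'.symm heo.symm hee.symm (he'.mem hr1)
        (h ▸ he.mem hr'))
      exact absurd hr''.1 (this ▸ ht.1.not_ge)
  obtain ⟨V, hV, hVs⟩ := exists_nhds_sameSide_of_sameSide (C := D.triangle o u y)
    (A₁ := fa '' Icc 0 s) (A₂ := fb '' Icc 0 t)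
    (L := fa '' Icc s 1 ∪ D.arc a b ∪ fb '' Icc t 1) (x := D.vert o) (p₁ := fa s) (p₂ := fb t)
    (isCompact_triangle huo.symm huy hyo.symm).isClosed
    (Or.inl (Or.inl (vert_left_mem huo.symm)))
    (isPreconnected_triangle_sdiff_vert huo.symm huy hyo.symm)
    (ha.isCompact_image le_rfl hs.2.le) (hb.isCompact_image le_rfl ht.2.le)
    (((ha.isCompact_image hs.1.le le_rfl).union (isCompact_arc hab)).union
      (hb.isCompact_image ht.1.le le_rfl)) hsT htT
    (fun z hz => hdis ha hb hao hbo hab hs ht z hz.1 hz.2)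
    (fun z hz => hdis hb ha hbo hao hab.symm ht hs z hz.1 (by
      rw [D.arc_symm b a]
      exact hz.2.elim (fun h => h.elim Or.inr fun h => Or.inl (Or.inr h))
        fun h => Or.inl (Or.inl h)))
    (by
      rintro ((⟨r, hr, h⟩ | h) | ⟨r, hr, h⟩)
      · exact absurd hr.1 (ha.eq_zero ⟨hs.1.le.trans hr.1, hr.2⟩ h ▸ hs.1.not_ge)
      · exact vert_notMem_arc hab hao.symm hbo.symm h
      · exact absurd hr.1 (hb.eq_zero ⟨ht.1.le.trans hr.1, hr.2⟩ h ▸ ht.1.not_ge))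
    (hsp.trans htp.symm)
  have hsub : D.triangle o a b ⊆
      fa '' Icc 0 s ∪ fb '' Icc 0 t ∪ (fa '' Icc s 1 ∪ D.arc a b ∪ fb '' Icc t 1) := by
    rintro z ((hz | hz) | hz)
    · obtain ⟨r, hr, rfl⟩ := ha.exists_eq hz
      rcases le_total r s with h | h
      · exact Or.inl (Or.inl ⟨r, ⟨hr.1, h⟩, rfl⟩)
      · exact Or.inr (Or.inl (Or.inl ⟨r, ⟨h, hr.2⟩, rfl⟩))
    · exact Or.inr (Or.inl (Or.inr hz))
    · obtain ⟨r, hr, rfl⟩ := hb.exists_eq hz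
      rcases le_total r t with h | h
      · exact Or.inl (Or.inr ⟨r, ⟨hr.1, h⟩, rfl⟩)
      · exact Or.inr (Or.inr ⟨r, ⟨h, hr.2⟩, rfl⟩)
  have hu' := hu.eventually_mem.and (hu.tendsto_zero hV)
  have hy' := hy.eventually_mem.and (hy.tendsto_zero hV)
  obtain ⟨r, ⟨hr, hro⟩, hrV⟩ := hu'.exists
  refine ⟨fu r, ?_, ?_⟩
  · filter_upwards [hu'] with w hw
    exact (hVs _ ⟨Or.inl (Or.inl hw.1.1), hw.2⟩ hw.1.2 _ ⟨Or.inl (Or.inl hr), hrV⟩ hro).mono hsub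
  · filter_upwards [hy'] with w hw
    exact (hVs _ ⟨Or.inr hw.1.1, hw.2⟩ hw.1.2 _ ⟨Or.inl (Or.inl hr), hrV⟩ hro).mono hsub

/-- If the edge `o a` crosses the edge `u y` of the triangle `o u y` and starts on the side of that
triangle containing `a`, then near the crossing `u y` stays on one side of any
triangle `o a b`. -/
theorem exists_nhds_sameSide_triangle (ha : D.IsArcParam o a fa) (hg : D.IsArcParam u y g)
    (hao : a ≠ o) (huo : u ≠ o) (hyo : y ≠ o) (hbo : b ≠ o) (hab : a ≠ b) (hau : a ≠ u)
    (hay : a ≠ y) (huy : u ≠ y) {τ : ℝ} (hτ : τ ∈ Icc (0 : ℝ) 1) (hx : g τ ∈ D.arc o a)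
    (h : GermSide (D.triangle o u y) fa (D.vert a)) :
    ∃ V ∈ nhds (g τ), ∀ z ∈ D.arc u y ∩ V, z ≠ g τ → ∀ w ∈ D.arc u y ∩ V, w ≠ g τ →
      SameSide (D.triangle o a b) z w := by
  obtain ⟨σ, hσ, hσx⟩ := ha.exists_eq hx
  have hxT := hg.mem hτ
  have hσ0 : 0 < σ := hσ.1.lt_of_ne fun h0 =>
    vert_notMem_arc huy huo.symm hyo.symm (ha.map_zero ▸ h0 ▸ hσx ▸ hxT)
  have hσ1 : σ < 1 := hσ.2.lt_of_ne fun h1 =>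
    vert_notMem_arc huy hau hay (ha.map_one ▸ h1 ▸ hσx ▸ hxT)
  have hτ' : τ ∈ Ioo (0 : ℝ) 1 := by
    refine ⟨hτ.1.lt_of_ne fun h0 => ?_, hτ.2.lt_of_ne fun h1 => ?_⟩
    · exact vert_notMem_arc hao.symm huo hau.symm (hg.map_zero ▸ h0 ▸ hx)
    · exact vert_notMem_arc hao.symm hyo hay.symm (hg.map_one ▸ h1 ▸ hx)
  have hhit : ∀ t ∈ Icc (0 : ℝ) 1, fa t ∈ D.triangle o u y → t = 0 ∨ t = σ := by
    rintro t ht ((h | h) | h)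
    · exact Or.inl (ha.eq_zero ht (eq_vert_of_mem hao.symm huo.symm hau (ha.mem ht) h))
    · refine Or.inr (ha.injOn ht hσ (D.inter_subsingleton o a u y hao.symm huy ?_
        ⟨ha.mem ht, h⟩ ⟨ha.mem hσ, hσx ▸ hxT⟩))
      simp [huo.symm, hyo.symm]
    · exact Or.inl (ha.eq_zero ht (eq_vert_of_mem hao.symm hyo.symm hay (ha.mem ht) h))
  have hm : σ / 2 ∈ Ioo 0 σ := ⟨half_pos hσ0, half_lt_self hσ0⟩
  have hgerm : GermSide (D.triangle o u y) fa (fa (σ / 2)) := by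
    refine ha.germSide ordConnected_Ioo hσ0 subset_rfl (fun t ht => ⟨ht.1.le, ht.2.le.trans hσ.2⟩)
      (fun t ht htT => ?_) hm
    exact (hhit t ⟨ht.1.le, ht.2.le.trans hσ.2⟩ htT).elim ht.1.ne' ht.2.ne
  have hob : ∀ t ∈ Icc (0 : ℝ) 1, fa t ∈ D.arc o b → t = 0 := fun t ht h =>
    ha.eq_zero ht (eq_vert_of_mem hao.symm hbo.symm hab (ha.mem ht) h)
  have haab : ∀ t ∈ Icc (0 : ℝ) 1, fa t ∈ D.arc a b → t = 1 := fun t ht h =>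
    ha.eq_one ht (eq_vert_of_mem hao hab hbo.symm (D.arc_symm o a ▸ ha.mem ht) h)
  obtain ⟨V, hV, hVs⟩ := exists_nhds_sameSide_of_sameSide (C := D.triangle o u y)
    (A₁ := fa '' Icc (σ / 2) σ) (A₂ := fa '' Icc σ 1)
    (L := fa '' Icc 0 (σ / 2) ∪ D.arc a b ∪ D.arc o b) (x := g τ) (p₁ := fa (σ / 2))
    (p₂ := D.vert a) (isCompact_triangle huo.symm huy hyo.symm).isClosed
    (Or.inl (Or.inr hxT)) (isPreconnected_triangle_sdiff huo.symm huy hyo.symm hg hτ')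
    (ha.isCompact_image hm.1.le hσ.2) (ha.isCompact_image hσ.1 le_rfl)
    (((ha.isCompact_image le_rfl (hm.2.le.trans hσ.2)).union (isCompact_arc hab)).union
      (isCompact_arc hbo.symm))
    (by
      rintro _ ⟨⟨t, ht, rfl⟩, htT⟩
      rcases hhit t ⟨hm.1.le.trans ht.1, ht.2.trans hσ.2⟩ htT with h | rfl
      · exact absurd ht.1 (h ▸ hm.1.not_ge)
      · exact hσx)
    (by
      rintro _ ⟨⟨t, ht, rfl⟩, htT⟩
      rcases hhit t ⟨hσ.1.trans ht.1, ht.2⟩ htT with h | rfl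
      · exact absurd ht.1 (h ▸ hσ0.not_ge)
      · exact hσx)
    (by
      rintro _ ⟨⟨t, ht, rfl⟩, (⟨s, hs, hst⟩ | h) | h⟩
      · have ht' : t ∈ Icc (0 : ℝ) 1 := ⟨hm.1.le.trans ht.1, ht.2.trans hσ.2⟩
        have := ha.injOn ⟨hs.1, hs.2.trans (ht.1.trans ht'.2)⟩ ht' hst
        rw [show t = σ / 2 from le_antisymm (this ▸ hs.2) ht.1]
        rfl
      · exact absurd ht.2
          (haab t ⟨hm.1.le.trans ht.1, ht.2.trans hσ.2⟩ h ▸ hσ1.not_ge)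
      · exact absurd ht.1 (hob t ⟨hm.1.le.trans ht.1, ht.2.trans hσ.2⟩ h ▸ hm.1.not_ge))
    (by
      rintro _ ⟨⟨t, ht, rfl⟩, (⟨s, hs, hst⟩ | h) | h⟩
      · have ht' : t ∈ Icc (0 : ℝ) 1 := ⟨hσ.1.trans ht.1, ht.2⟩
        have := ha.injOn ⟨hs.1, hs.2.trans (hm.2.le.trans hσ.2)⟩ ht' hst
        exact absurd (this ▸ hs.2 : t ≤ σ / 2) (hm.2.trans_le ht.1).not_ge
      · rw [haab t ⟨hσ.1.trans ht.1, ht.2⟩ h, ha.map_one]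
        rfl
      · exact absurd ht.1 (hob t ⟨hσ.1.trans ht.1, ht.2⟩ h ▸ hσ0.not_ge))
    (by
      rw [← hσx]
      rintro ((⟨s, hs, hst⟩ | h) | h)
      · exact absurd (ha.injOn ⟨hs.1, hs.2.trans (hm.2.le.trans hσ.2)⟩ hσ hst ▸ hs.2) hm.2.not_ge
      · exact hσ1.ne (haab σ hσ h)
      · exact hσ0.ne' (hob σ hσ h))
    (hgerm.unique h)
  refine ⟨V, hV, fun z hz hzx w hw hwx => (hVs z ⟨Or.inl (Or.inr hz.1), hz.2⟩ hzx w
    ⟨Or.inl (Or.inr hw.1), hw.2⟩ hwx).mono ?_⟩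
  rintro z ((hz | hz) | hz)
  · obtain ⟨r, hr, rfl⟩ := ha.exists_eq hz
    rcases le_total r (σ / 2) with h | h
    · exact Or.inr (Or.inl (Or.inl ⟨r, ⟨hr.1, h⟩, rfl⟩))
    rcases le_total r σ with h' | h'
    · exact Or.inl (Or.inl ⟨r, ⟨h, h'⟩, rfl⟩)
    · exact Or.inl (Or.inr ⟨r, ⟨h', hr.2⟩, rfl⟩)
  · exact Or.inr (Or.inl (Or.inr hz))
  · exact Or.inr (Or.inr hz)

theorem finite_arc_inter_triangle (hij : i ≠ j) (hjk : j ≠ k) (hik : i ≠ k) (huy : u ≠ y)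
    (h1 : s(u, y) ≠ s(i, j)) (h2 : s(u, y) ≠ s(j, k)) (h3 : s(u, y) ≠ s(i, k)) :
    (D.arc u y ∩ D.triangle i j k).Finite := by
  rw [triangle, inter_union_distrib_left, inter_union_distrib_left]
  exact ((finite_arc_inter huy hij h1).union (finite_arc_inter huy hjk h2)).union
    (finite_arc_inter huy hik h3)

/-- If `a b` is crossed by no star edge, and the star edges to `a` and `b` start on one common side
of the triangle `o u y` that contains `a` and `b`, then `u y` lies on one side of the
triangle `o a b`. -/
theorem sameSide_triangle_of_arc (ha : D.IsArcParam o a fa) (hb : D.IsArcParam o b fb)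
    (hu : D.IsArcParam o u fu) (hy : D.IsArcParam o y fy) (hg : D.IsArcParam u y g)
    (hao : a ≠ o) (hbo : b ≠ o) (huo : u ≠ o) (hyo : y ≠ o) (hab : a ≠ b) (hub : u ≠ b)
    (hay : a ≠ y) (hby : b ≠ y) (huy : u ≠ y)
    (hdisj : ∀ w, w ≠ o → w ≠ a → w ≠ b → Disjoint (D.arc o w) (D.arc a b))
    (hA : u ≠ a →
      GermSide (D.triangle o u y) fa (D.vert a) ∧ GermSide (D.triangle o u y) fa p)
    (hB : GermSide (D.triangle o u y) fb (D.vert b) ∧ GermSide (D.triangle o u y) fb p)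
    {t : ℝ} (ht : t ∈ Icc (0 : ℝ) 1) (htK : g t ∉ D.triangle o a b) :
    SameSide (D.triangle o a b) (g t) (D.vert y) := by
  have hK := (isCompact_triangle (D := D) hao.symm hab hbo.symm).isClosed
  have hyK : D.vert y ∉ D.triangle o a b := by
    rintro ((h | h) | h)
    · exact vert_notMem_arc hao.symm hyo hay.symm h
    · exact vert_notMem_arc hab hay.symm hby.symm h
    · exact vert_notMem_arc hbo.symm hyo hby.symm h
  have hfin : (D.arc u y ∩ D.triangle o a b).Finite := by
    apply finite_arc_inter_triangle hao.symm hab hbo.symm huy <;>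
      simp [hyo, hay.symm, hby.symm]
  have hfin' := hg.finite_hits hfin
  have huse : ∀ I ⊆ Icc (0 : ℝ) 1, IsPreconnected I → (∀ r ∈ I, g r ∉ D.arc a b) →
      ∀ r ∈ I, ∀ s ∈ I, g r ∉ D.triangle o a b → g s ∉ D.triangle o a b →
      SameSide (D.triangle o a b) (g r) (g s) := by
    intro I hI hIc hIab r hr s hs hrK hsK
    refine sameSide_of_locally hK hIc (hg.continuousOn.mono hI)
      (hfin'.subset fun x hx => ⟨hI hx.1, hx.2⟩) (fun x hx hxK => ?_) hr hrK hs hsK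
    have hnhds : ∃ V ∈ nhds (g x), ∀ z ∈ D.arc u y ∩ V, z ≠ g x → ∀ w ∈ D.arc u y ∩ V, w ≠ g x →
        SameSide (D.triangle o a b) z w := by
      rcases hxK with (h | h) | h
      · have hua : u ≠ a := by
          rintro rfl
          refine hIab x hx ?_
          rw [eq_vert_of_mem huy huo hyo (hg.mem (hI hx)) (D.arc_symm o u ▸ h)]
          exact vert_left_mem hab
        exact exists_nhds_sameSide_triangle ha hg hao huo hyo hbo hab hua.symm hay huy (hI hx) h
          (hA hua).1
      · exact absurd h (hIab x hx)
      · rw [triangle_comm]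
        exact exists_nhds_sameSide_triangle hb hg hbo huo hyo hao hab.symm hub.symm hby huy (hI hx) h
          hB.1
    obtain ⟨V, hV, hVs⟩ := hnhds
    refine ⟨g ⁻¹' V ∩ I, Filter.inter_mem (hg.continuousOn.mono hI x hx hV) self_mem_nhdsWithin,
      fun r hr hrK s hs hsK => hVs _ ⟨hg.mem (hI hr.2), hr.1⟩ ?_ _ ⟨hg.mem (hI hs.2), hs.1⟩ ?_⟩
    · exact fun h => hrK (h ▸ hxK)
    · exact fun h => hsK (h ▸ hxK)
  by_cases hhit : ∃ s ∈ Icc t 1, g s ∈ D.arc a b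
  · obtain ⟨s, hs, hsab⟩ := hhit
    have hs' : s ∈ Icc (0 : ℝ) 1 := ⟨ht.1.trans hs.1, hs.2⟩
    have huniq : ∀ r ∈ Icc (0 : ℝ) 1, g r ∈ D.arc a b → r = s := fun r hr h =>
      hg.injOn hr hs' (D.inter_subsingleton u y a b huy hab (by simp [hay.symm, hby.symm])
        ⟨hg.mem hr, h⟩ ⟨hg.mem hs', hsab⟩)
    have hts : t < s := hs.1.lt_of_ne fun h => htK (Or.inl (Or.inr (h ▸ hsab)))
    have hua : u ≠ a := by
      rintro rfl
      have := huniq 0 (by simp) (hg.map_zero ▸ vert_left_mem hab)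
      exact (this ▸ hts).not_ge ht.1
    have huK : D.vert u ∉ D.triangle o a b := by
      rintro ((h | h) | h)
      · exact vert_notMem_arc hao.symm huo hua h
      · exact vert_notMem_arc hab hua hub h
      · exact vert_notMem_arc hbo.symm huo hub h
    obtain ⟨q, hq, hq'⟩ := exists_germSide_of_germSide ha hb hu hy hao hbo huo hyo hab huy
      (hA hua).2 hB.2
    have hstar : ∀ {e : Fin n} {fe : ℝ → ℝ × ℝ}, D.IsArcParam o e fe → e ≠ o → e ≠ a → e ≠ b →
        GermSide (D.triangle o a b) fe (D.vert e) := by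
      intro e fe he heo hea heb
      refine he.germSide_vert ?_
      rintro z ⟨hz, (h | h) | h⟩
      · exact eq_vert_of_mem heo.symm hao.symm hea hz h
      · exact absurd h (disjoint_left.1 (hdisj e heo hea heb) hz)
      · exact eq_vert_of_mem heo.symm hbo.symm heb hz h
    have h0 : SameSide (D.triangle o a b) (g t) (g 0) :=
      huse (Icc 0 t) (Icc_subset_Icc le_rfl ht.2) isPreconnected_Icc
        (fun r hr h => (hr.2.trans_lt hts).ne (huniq r ⟨hr.1, hr.2.trans ht.2⟩ h))
        t ⟨ht.1, le_rfl⟩ 0 ⟨le_rfl, ht.1⟩ htK (hg.map_zero ▸ huK)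
    rw [hg.map_zero] at h0
    exact (h0.trans ((hstar hu huo hua hub).unique hq)).trans
      (hq'.unique (hstar hy hyo hay.symm hby.symm))
  · rw [← hg.map_one]
    exact huse (Icc t 1) (Icc_subset_Icc ht.1 le_rfl) isPreconnected_Icc
      (fun r hr h => hhit ⟨r, hr, h⟩) t ⟨le_rfl, ht.2⟩ 1 ⟨ht.2, le_rfl⟩ htK (hg.map_one ▸ hyK)

/-- Let `a`, `b`, `c` be such that no star edge crosses `a b` or `b c` and `o a`, `o c` separate
`o b` from `o y` at `o`. If `u y` crosses `o b`, then it is impossible that the star edges to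
`a`, `b`, `c` start on a common side of the triangle `o u y` that contains `a`, `b`, `c`. -/
theorem false_of_consecutive (ha : D.IsArcParam o a fa) (hb : D.IsArcParam o b fb)
    (hc : D.IsArcParam o c fc) (hu : D.IsArcParam o u fu) (hy : D.IsArcParam o y fy)
    (hg : D.IsArcParam u y g) (hao : a ≠ o) (hbo : b ≠ o) (hco : c ≠ o) (huo : u ≠ o) (hyo : y ≠ o)
    (hab : a ≠ b) (hbc : b ≠ c) (hac : a ≠ c) (hub : u ≠ b) (hay : a ≠ y) (hby : b ≠ y)
    (hcy : c ≠ y) (huy : u ≠ y)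
    (hdab : ∀ w, w ≠ o → w ≠ a → w ≠ b → Disjoint (D.arc o w) (D.arc a b))
    (hdcb : ∀ w, w ≠ o → w ≠ c → w ≠ b → Disjoint (D.arc o w) (D.arc c b))
    (hsep : ∀ q, GermSide (D.triangle o a c) fb q → ¬ GermSide (D.triangle o a c) fy q)
    (hA : u ≠ a →
      GermSide (D.triangle o u y) fa (D.vert a) ∧ GermSide (D.triangle o u y) fa p)
    (hB : GermSide (D.triangle o u y) fb (D.vert b) ∧ GermSide (D.triangle o u y) fb p)
    (hC : u ≠ c →
      GermSide (D.triangle o u y) fc (D.vert c) ∧ GermSide (D.triangle o u y) fc p)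
    {x : ℝ × ℝ} (hxb : x ∈ D.arc o b) (hxu : x ∈ D.arc u y) : False := by
  set C : Set (ℝ × ℝ) := (D.arc o a ∪ D.arc a b) ∪ (D.arc c b ∪ D.arc o c) with hCdef
  have hCc : IsCompact C := ((isCompact_arc hao.symm).union (isCompact_arc hab)).union
    ((isCompact_arc hbc.symm).union (isCompact_arc hco.symm))
  obtain ⟨σ, hσ, hσx⟩ := hb.exists_eq hxb
  obtain ⟨τ, hτ, hτx⟩ := hg.exists_eq hxu
  have hxo : x ≠ D.vert o := by
    rintro rfl
    exact vert_notMem_arc huy huo.symm hyo.symm hxu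
  have hxb' : x ≠ D.vert b := by
    rintro rfl
    exact vert_notMem_arc huy hub.symm hby hxu
  have hobC : ∀ z ∈ D.arc o b, z ∈ C → z = D.vert o ∨ z = D.vert b := by
    rintro z hz ((h | h) | (h | h))
    · exact Or.inl (eq_vert_of_mem hbo.symm hao.symm hab.symm hz h)
    · exact Or.inr (eq_vert_of_mem hbo hab.symm hao.symm (D.arc_symm o b ▸ hz)
        (D.arc_symm a b ▸ h))
    · exact Or.inr (eq_vert_of_mem hbo hbc hco.symm (D.arc_symm o b ▸ hz)
        (D.arc_symm c b ▸ h))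
    · exact Or.inl (eq_vert_of_mem hbo.symm hco.symm hbc hz h)
  have hxC : x ∉ C := fun h => (hobC x hxb h).elim hxo hxb'
  have hfin : (D.arc u y ∩ (D.triangle o a b ∪ D.triangle o c b)).Finite := by
    rw [inter_union_distrib_left]
    refine Finite.union ?_ ?_
    · apply finite_arc_inter_triangle hao.symm hab hbo.symm huy <;> simp [hyo, hay.symm, hby.symm]
    · apply finite_arc_inter_triangle hco.symm hbc.symm hbo.symm huy <;>
        simp [hyo, hcy.symm, hby.symm]
  obtain ⟨t, htx, ht, htK⟩ := isPreconnected_Icc.exists_notMem_of_finite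
    ⟨0, by simp, 1, by simp, zero_ne_one⟩ (hg.finite_hits hfin) hτ
    (hg.continuousOn τ hτ (SameSide.eventually hCc.isClosed (hτx.symm ▸ hxC)))
  have htK' : g t ∉ D.triangle o a b ∪ D.triangle o c b := fun h => htK ⟨ht, h⟩
  have h1 := sameSide_triangle_of_arc ha hb hu hy hg hao hbo huo hyo hab hub hay hby huy hdab hA hB
    ht fun h => htK' (Or.inl h)
  have h2 := sameSide_triangle_of_arc hc hb hu hy hg hco hbo huo hyo hbc.symm hub hcy hby huy hdcb
    hC hB ht fun h => htK' (Or.inr h)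
  have hinter : D.triangle o a b ∩ D.triangle o c b = D.arc o b := by
    refine Subset.antisymm ?_ fun z hz => ⟨Or.inr hz, Or.inr hz⟩
    rintro z ⟨(h | h) | h, (h' | h') | h'⟩
    · exact eq_vert_of_mem hao.symm hco.symm hac h h' ▸ vert_left_mem hbo.symm
    · exact absurd h' (disjoint_left.1 (hdcb a hao hac hab) h)
    · exact h'
    · exact absurd h (disjoint_left.1 (hdab c hco hac.symm hbc.symm) h')
    · rw [show z = D.vert b from eq_vert_of_mem hab.symm hbc hac
        (D.arc_symm a b ▸ h) (D.arc_symm c b ▸ h')]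
      exact vert_right_mem hbo.symm
    all_goals first | exact h' | exact h
  have h3 : SameSide C x (D.vert y) := by
    rw [← hτx]
    refine SameSide.trans htx ((janiszewski (isCompact_triangle hao.symm hab hbo.symm)
      (isCompact_triangle hco.symm hbc.symm hbo.symm)
      (hinter ▸ isPreconnected_arc hbo.symm) h1 h2).mono ?_)
    rintro z ((h | h) | (h | h))
    exacts [Or.inl (Or.inl (Or.inl h)), Or.inl (Or.inl (Or.inr h)), Or.inr (Or.inl (Or.inr h)),
      Or.inr (Or.inl (Or.inl h))]
  have hgb : GermSide C fb (D.vert y) := by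
    refine GermSide.trans (p := fb σ) ?_ (hσx.symm ▸ h3)
    refine hb.germSide ordConnected_Ioo one_pos subset_rfl Ioo_subset_Icc_self (fun t ht htC => ?_)
      ⟨hσ.1.lt_of_ne fun h => hxo ?_, hσ.2.lt_of_ne fun h => hxb' ?_⟩
    · have ht' := Ioo_subset_Icc_self ht
      exact (hobC _ (hb.mem ht') htC).elim (fun h => ht.1.ne' (hb.eq_zero ht' h))
        fun h => ht.2.ne (hb.eq_one ht' h)
    · rw [← hσx, ← h, hb.map_zero]
    · rw [← hσx, h, hb.map_one]
  have hgy : GermSide C fy (D.vert y) := by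
    refine hy.germSide_vert ?_
    rintro z ⟨hz, (h | h) | (h | h)⟩
    · exact eq_vert_of_mem hyo.symm hao.symm hay.symm hz h
    · exact absurd h (disjoint_left.1 (hdab y hyo hay.symm hby.symm) hz)
    · exact absurd h (disjoint_left.1 (hdcb y hyo hcy.symm hby.symm) hz)
    · exact eq_vert_of_mem hyo.symm hco.symm hcy.symm hz h
  set K : Set (ℝ × ℝ) := D.arc a b ∪ D.arc c b ∪ D.arc a c with hKdef
  have hKc : IsCompact K :=
    ((isCompact_arc hab).union (isCompact_arc hbc.symm)).union (isCompact_arc hac)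
  have hoK : D.vert o ∉ K := by
    rintro ((h | h) | h)
    · exact vert_notMem_arc hab hao.symm hbo.symm h
    · exact vert_notMem_arc hbc.symm hco.symm hbo.symm h
    · exact vert_notMem_arc hac hao.symm hco.symm h
  have hCK : C ∩ K = D.arc a b ∪ D.arc c b := by
    refine Subset.antisymm ?_ ?_
    · rintro z ⟨h, h' | h'⟩
      · exact h'
      · rcases h with (h | h) | (h | h)
        · rw [eq_vert_of_mem hao hac hco.symm (D.arc_symm o a ▸ h) h']
          exact Or.inl (vert_left_mem hab)
        · exact Or.inl h
        · exact Or.inr h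
        · rw [show z = D.vert c from eq_vert_of_mem hco hac.symm hao.symm
            (D.arc_symm o c ▸ h) (D.arc_symm a c ▸ h')]
          exact Or.inr (vert_left_mem hbc.symm)
    · rintro z (h | h)
      · exact ⟨Or.inl (Or.inr h), Or.inl (Or.inl h)⟩
      · exact ⟨Or.inr (Or.inl h), Or.inl (Or.inr h)⟩
  have hpre : IsPreconnected (C ∩ K) := hCK ▸ (isPreconnected_arc hab).union (D.vert b)
    (vert_right_mem hab) (vert_right_mem hbc.symm) (isPreconnected_arc hbc.symm)
  have hsub : D.triangle o a c ⊆ C ∪ K := by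
    rintro z ((h | h) | h)
    exacts [Or.inl (Or.inl (Or.inl h)), Or.inr (Or.inr h), Or.inl (Or.inr (Or.inr h))]
  have hoK' := SameSide.eventually hKc.isClosed hoK
  have hb' := Filter.Eventually.and hgb (hb.tendsto_zero hoK')
  have hy' := Filter.Eventually.and hgy (hy.tendsto_zero hoK')
  obtain ⟨r, hr, hrK⟩ := hb'.exists
  refine hsep (fb r) ?_ ?_
  · filter_upwards [hb'] with s hs
    exact (janiszewski hCc hKc hpre (hs.1.trans hr.symm) (hs.2.symm.trans hrK)).mono hsub
  · filter_upwards [hy'] with s hs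
    exact (janiszewski hCc hKc hpre (hs.1.trans hr.symm) (hs.2.symm.trans hrK)).mono hsub

/-- If `u y` crosses a star edge, then the triangle `o u y` has at most one side
apart from the one at which that star edge starts. -/
theorem sameSide_of_not_sameSide (ha : D.IsArcParam o a fa) (hg : D.IsArcParam u y g)
    (hao : a ≠ o) (huo : u ≠ o) (hyo : y ≠ o) (hau : a ≠ u) (hay : a ≠ y) (huy : u ≠ y)
    {x : ℝ × ℝ} (hxa : x ∈ D.arc o a) (hxu : x ∈ D.arc u y)
    (hp : GermSide (D.triangle o u y) fa p) {q r : ℝ × ℝ} (hq : q ∉ D.triangle o u y)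
    (hr : r ∉ D.triangle o u y) (hpq : ¬ SameSide (D.triangle o u y) p q)
    (hpr : ¬ SameSide (D.triangle o u y) p r) : SameSide (D.triangle o u y) q r := by
  obtain ⟨σ, hσ, hσx⟩ := ha.exists_eq hxa
  obtain ⟨τ, hτ, rfl⟩ := hg.exists_eq hxu
  have hσ0 : 0 < σ := hσ.1.lt_of_ne fun h0 =>
    vert_notMem_arc huy huo.symm hyo.symm (ha.map_zero ▸ h0 ▸ hσx ▸ hxu)
  have hτ0 : 0 < τ := hτ.1.lt_of_ne fun h0 =>
    vert_notMem_arc hao.symm huo hau.symm (hg.map_zero ▸ h0 ▸ hxa)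
  have hτ1 : τ < 1 := hτ.2.lt_of_ne fun h1 =>
    vert_notMem_arc hao.symm hyo hay.symm (hg.map_one ▸ h1 ▸ hxa)
  have hgu : ∀ t ∈ Icc (0 : ℝ) 1, g t ∈ D.arc o u → t = 0 := fun t ht h =>
    hg.eq_zero ht (eq_vert_of_mem huy huo hyo (hg.mem ht) (D.arc_symm o u ▸ h))
  have hgy : ∀ t ∈ Icc (0 : ℝ) 1, g t ∈ D.arc o y → t = 1 := fun t ht h =>
    hg.eq_one ht (eq_vert_of_mem huy.symm hyo huo (D.arc_symm u y ▸ hg.mem ht)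
      (D.arc_symm o y ▸ h))
  have hsplit : D.arc u y = g '' Icc 0 τ ∪ g '' Icc τ 1 := by
    rw [← image_union, Icc_union_Icc_eq_Icc hτ.1 hτ.2, hg.image_eq]
  set α := D.arc o u ∪ g '' Icc 0 τ with hαdef
  set β := D.arc o y ∪ g '' Icc τ 1 with hβdef
  have hT : D.triangle o u y = α ∪ β := by
    rw [triangle, hsplit, hαdef, hβdef]
    ac_rfl
  have hαβ : α ∩ β ⊆ {D.vert o, g τ} := by
    rintro z ⟨h | ⟨t, ht, rfl⟩, h' | ⟨s, hs, h'⟩⟩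
    · exact Or.inl (eq_vert_of_mem huo.symm hyo.symm huy h h')
    · have hs' : s ∈ Icc (0 : ℝ) 1 := ⟨hτ.1.trans hs.1, hs.2⟩
      exact absurd hs.1 (hgu s hs' (h' ▸ h) ▸ hτ0.not_ge)
    · exact absurd ht.2 (hgy t ⟨ht.1, ht.2.trans hτ.2⟩ h' ▸ hτ1.not_ge)
    · have := hg.injOn ⟨hτ.1.trans hs.1, hs.2⟩ ⟨ht.1, ht.2.trans hτ.2⟩ h'
      rw [show t = τ from le_antisymm ht.2 (this ▸ hs.1)]
      exact Or.inr rfl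
  have hmem : ({D.vert o, g τ} : Set (ℝ × ℝ)) ⊆ α ∩ β := by
    rintro z (rfl | rfl)
    · exact ⟨Or.inl (vert_left_mem huo.symm), Or.inl (vert_left_mem hyo.symm)⟩
    · exact ⟨Or.inr ⟨τ, ⟨hτ.1, le_rfl⟩, rfl⟩, Or.inr ⟨τ, ⟨le_rfl, hτ.2⟩, rfl⟩⟩
  have hαβ' : α ∩ β = {D.vert o, g τ} := hαβ.antisymm hmem
  have ho : ∀ t ∈ Icc (0 : ℝ) 1, g t ≠ D.vert o := fun t ht h =>
    vert_notMem_arc huy huo.symm hyo.symm (h ▸ hg.mem ht)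
  have hα : (α ∪ β) \ β = D.arc o u \ {D.vert o} ∪ g '' Ico 0 τ := by
    rw [union_sdiff_right, ← sdiff_self_inter, hαβ']
    ext z
    constructor
    · rintro ⟨h | ⟨t, ht, rfl⟩, hz⟩
      · exact Or.inl ⟨h, fun h => hz (Or.inl h)⟩
      · exact Or.inr ⟨t, ⟨ht.1, ht.2.lt_of_ne fun h => hz (Or.inr (h ▸ rfl))⟩, rfl⟩
    · rintro (⟨h, hz⟩ | ⟨t, ht, rfl⟩)
      · exact ⟨Or.inl h, fun h' => h'.elim hz fun h' => hτ0.ne' (hgu τ hτ (h' ▸ h))⟩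
      · have ht' : t ∈ Icc (0 : ℝ) 1 := ⟨ht.1, ht.2.le.trans hτ.2⟩
        exact ⟨Or.inr ⟨t, ⟨ht.1, ht.2.le⟩, rfl⟩,
          fun h => h.elim (ho t ht') fun h => ht.2.ne (hg.injOn ht' hτ h)⟩
  have hβ : (α ∪ β) \ α = D.arc o y \ {D.vert o} ∪ g '' Ioc τ 1 := by
    rw [union_sdiff_left, ← sdiff_inter_self_eq_sdiff, hαβ']
    ext z
    constructor
    · rintro ⟨h | ⟨t, ht, rfl⟩, hz⟩
      · exact Or.inl ⟨h, fun h => hz (Or.inl h)⟩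
      · exact Or.inr ⟨t, ⟨ht.1.lt_of_ne fun h => hz (Or.inr (h ▸ rfl)), ht.2⟩, rfl⟩
    · rintro (⟨h, hz⟩ | ⟨t, ht, rfl⟩)
      · exact ⟨Or.inl h, fun h' => h'.elim hz fun h' => hτ1.ne (hgy τ hτ (h' ▸ h))⟩
      · have ht' : t ∈ Icc (0 : ℝ) 1 := ⟨hτ.1.trans ht.1.le, ht.2⟩
        exact ⟨Or.inr ⟨t, ⟨ht.1.le, ht.2⟩, rfl⟩,
          fun h => h.elim (ho t ht') fun h => ht.1.ne' (hg.injOn ht' hτ h)⟩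
  have hvu : D.vert u ∈ D.arc o u \ {D.vert o} := ⟨vert_right_mem huo.symm, D.vert_inj.ne huo⟩
  have hvy : D.vert y ∈ D.arc o y \ {D.vert o} := ⟨vert_right_mem hyo.symm, D.vert_inj.ne hyo⟩
  have hnonsep : ∀ {e : Fin n} {s t : ℝ}, e ≠ o → 0 ≤ s → s ≤ t → t ≤ 1 →
      D.arc o e ∩ g '' Icc s t ⊆ {D.vert e} → ∀ p q, p ∉ D.arc o e ∪ g '' Icc s t →
      q ∉ D.arc o e ∪ g '' Icc s t → SameSide (D.arc o e ∪ g '' Icc s t) p q := by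
    intro e s t he hs hst ht hsub p q hp hq
    obtain ⟨fe, hfe⟩ := exists_isArcParam (D := D) he.symm
    refine janiszewski (isCompact_arc he.symm) (hg.isCompact_image hs ht)
      (subsingleton_singleton.anti hsub).isPreconnected ?_
      (hg.sameSide_image hs hst ht (fun h => hp (Or.inr h)) fun h => hq (Or.inr h))
    have := hfe.sameSide_image le_rfl zero_le_one le_rfl (p := p) (q := q)
    rw [hfe.image_eq] at this
    exact this (fun h => hp (Or.inl h)) fun h => hq (Or.inl h)
  rw [hT] at hp hq hr hpq hpr ⊢
  have hL : ∀ t ∈ Icc 0 σ, fa t ∈ α ∪ β → t = 0 ∨ t = σ := by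
    intro t ht h
    have ht' : t ∈ Icc (0 : ℝ) 1 := ⟨ht.1, ht.2.trans hσ.2⟩
    rw [← hT] at h
    rcases h with (h | h) | h
    · exact Or.inl (ha.eq_zero ht' (eq_vert_of_mem hao.symm huo.symm hau (ha.mem ht') h))
    · refine Or.inr (ha.injOn ht' hσ (D.inter_subsingleton o a u y hao.symm huy ?_
        ⟨ha.mem ht', h⟩ ⟨ha.mem hσ, hσx ▸ hxu⟩))
      simp [huo.symm, hyo.symm]
    · exact Or.inl (ha.eq_zero ht' (eq_vert_of_mem hao.symm hyo.symm hay (ha.mem ht') h))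
  refine sameSide_of_crosscut (L := fa '' Icc 0 σ) (p := p)
    ((isCompact_arc huo.symm).union (hg.isCompact_image le_rfl hτ.2))
    ((isCompact_arc hyo.symm).union (hg.isCompact_image hτ.1 le_rfl))
    (ha.isCompact_image le_rfl hσ.2)
    (ha.isPreconnected_image ordConnected_Icc (Icc_subset_Icc le_rfl hσ.2)) ?_
    (hnonsep huo le_rfl hτ.1 hτ.2 ?_) (hnonsep hyo hτ.1 hτ.2 le_rfl ?_)
    ?_ ?_ ?_ ?_ ?_ ?_ hq hr hpq hpr
  · rw [hαβ']
    rintro z (rfl | rfl)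
    · exact ⟨0, ⟨le_rfl, hσ.1⟩, ha.map_zero⟩
    · exact ⟨σ, ⟨hσ.1, le_rfl⟩, hσx⟩
  · rintro _ ⟨h, ⟨t, ht, rfl⟩⟩
    rw [hgu t ⟨ht.1, ht.2.trans hτ.2⟩ h, hg.map_zero]
    rfl
  · rintro _ ⟨h, ⟨t, ht, rfl⟩⟩
    rw [hgy t ⟨hτ.1.trans ht.1, ht.2⟩ h, hg.map_one]
    rfl
  · rw [hα]
    exact (isPreconnected_arc_sdiff huo.symm).union (D.vert u) hvu
      ⟨0, ⟨le_rfl, hτ0⟩, hg.map_zero⟩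
      (hg.isPreconnected_image ordConnected_Ico fun t ht => ⟨ht.1, ht.2.le.trans hτ.2⟩)
  · rw [hβ]
    exact (isPreconnected_arc_sdiff hyo.symm).union (D.vert y) hvy
      ⟨1, ⟨hτ1, le_rfl⟩, hg.map_one⟩
      (hg.isPreconnected_image ordConnected_Ioc fun t ht => ⟨hτ.1.trans ht.1.le, ht.2⟩)
  · exact hα ▸ ⟨_, Or.inl hvu⟩
  · exact hβ ▸ ⟨_, Or.inl hvy⟩
  · rintro _ ⟨⟨t, ht, rfl⟩, h⟩
    rw [hαβ']
    rcases hL t ht h with rfl | rfl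
    · exact Or.inl ha.map_zero
    · exact Or.inr hσx
  · rintro _ ⟨t, ht, rfl⟩ h
    have ht' : t ∈ Ioo 0 σ := by
      refine ⟨ht.1.lt_of_ne fun h0 => h ?_, ht.2.lt_of_ne fun h1 => h ?_⟩
      · rw [← h0, ha.map_zero]
        exact Or.inl (hmem (Or.inl rfl)).1
      · rw [h1, hσx]
        exact Or.inl (hmem (Or.inr rfl)).1
    refine hp.unique (ha.germSide ordConnected_Ioo hσ0 subset_rfl
      (fun t ht => ⟨ht.1.le, ht.2.le.trans hσ.2⟩) (fun t ht h => ?_) ht')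
    exact (hL t (Ioo_subset_Icc_self ht) h).elim ht.1.ne' ht.2.ne

/-- Every side of a triangle contains the vertices of the triangle. -/
theorem vert_mem_closure (hu : D.IsArcParam o u fu) (hy : D.IsArcParam o y fy)
    (huo : u ≠ o) (hyo : y ≠ o) (huy : u ≠ y) {q : ℝ × ℝ} (hq : q ∉ D.triangle o u y) :
    D.vert o ∈ closure {z | SameSide (D.triangle o u y) q z} := by
  by_contra hcl
  have hU := isClosed_closure.isOpen_compl.mem_nhds hcl
  obtain ⟨ε, hε, hε'⟩ := mem_nhdsGT_iff_exists_Ioo_subset.1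
    (Filter.Eventually.and (hu.tendsto_zero hU) (Filter.Eventually.and (hy.tendsto_zero hU)
      (Ioc_mem_nhdsGT (one_pos : (0 : ℝ) < 1))))
  have hm : ε / 2 ∈ Ioo 0 ε := ⟨half_pos hε, half_lt_self hε⟩
  set δ := ε / 2
  have hδ1 : δ ≤ 1 := (hε' hm).2.2.2
  have hsu : fu '' Icc δ 1 ⊆ D.arc o u := hu.image_subset (Icc_subset_Icc hm.1.le le_rfl)
  have hsy : fy '' Icc δ 1 ⊆ D.arc o y := hy.image_subset (Icc_subset_Icc hm.1.le le_rfl)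
  have hou : D.vert o ∉ fu '' Icc δ 1 := by
    rintro ⟨t, ht, h⟩
    exact absurd ht.1 (hu.eq_zero ⟨hm.1.le.trans ht.1, ht.2⟩ h ▸ hm.1.not_ge)
  have hoy : D.vert o ∉ fy '' Icc δ 1 := by
    rintro ⟨t, ht, h⟩
    exact absurd ht.1 (hy.eq_zero ⟨hm.1.le.trans ht.1, ht.2⟩ h ▸ hm.1.not_ge)
  obtain ⟨g, hg⟩ := exists_isArcParam (D := D) huy
  have hcu := hu.isCompact_image hm.1.le le_rfl
  have hcy := hy.isCompact_image hm.1.le le_rfl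
  have hnonsep : ∀ p q, p ∉ fu '' Icc δ 1 ∪ D.arc u y ∪ fy '' Icc δ 1 →
      q ∉ fu '' Icc δ 1 ∪ D.arc u y ∪ fy '' Icc δ 1 →
      SameSide (fu '' Icc δ 1 ∪ D.arc u y ∪ fy '' Icc δ 1) p q := by
    intro p q hp hq
    refine janiszewski (hcu.union (isCompact_arc huy)) hcy ?_
      (janiszewski hcu (isCompact_arc huy) ?_ ?_ ?_) ?_
    · refine (subsingleton_singleton (a := D.vert y)).anti ?_ |>.isPreconnected
      rintro z ⟨h | h, h'⟩
      · exact absurd h' (eq_vert_of_mem huo.symm hyo.symm huy (hsu h) (hsy h') ▸ hoy)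
      · exact eq_vert_of_mem huy.symm hyo huo (D.arc_symm u y ▸ h) (D.arc_symm o y ▸ hsy h')
    · refine (subsingleton_singleton (a := D.vert u)).anti ?_ |>.isPreconnected
      rintro z ⟨h, h'⟩
      exact eq_vert_of_mem huo huy hyo.symm (D.arc_symm o u ▸ hsu h) h'
    · exact hu.sameSide_image hm.1.le hδ1 le_rfl (fun h => hp (Or.inl (Or.inl h)))
        fun h => hq (Or.inl (Or.inl h))
    · rw [← hg.image_eq] at hp hq ⊢
      exact hg.sameSide_image le_rfl zero_le_one le_rfl (fun h => hp (Or.inl (Or.inr h)))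
        fun h => hq (Or.inl (Or.inr h))
    · exact hy.sameSide_image hm.1.le hδ1 le_rfl (fun h => hp (Or.inr h)) fun h => hq (Or.inr h)
  obtain ⟨z, hz, hzc⟩ := exists_mem_closure_component
    (isCompact_triangle huo.symm huy hyo.symm).isClosed hnonsep
    (union_subset (union_subset (hsu.trans fun z hz => Or.inl (Or.inl hz))
      fun z hz => Or.inl (Or.inr hz)) (hsy.trans fun z hz => Or.inr hz))
    ⟨D.vert o, Or.inl (Or.inl (vert_left_mem huo.symm)), by
      rintro ((h | h) | h)
      exacts [hou h, vert_notMem_arc huy huo.symm hyo.symm h, hoy h]⟩ hq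
  obtain ⟨(h | h) | h, hz⟩ := hz
  · obtain ⟨t, ht, rfl⟩ := hu.exists_eq h
    rcases ht.1.eq_or_lt with rfl | ht0
    · exact hcl (hu.map_zero ▸ hzc)
    rcases le_total δ t with h | h
    · exact hz (Or.inl (Or.inl ⟨t, ⟨h, ht.2⟩, rfl⟩))
    · exact (hε' ⟨ht0, h.trans_lt hm.2⟩).1 hzc
  · exact hz (Or.inl (Or.inr h))
  · obtain ⟨t, ht, rfl⟩ := hy.exists_eq h
    rcases ht.1.eq_or_lt with rfl | ht0
    · exact hcl (hy.map_zero ▸ hzc)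
    rcases le_total δ t with h | h
    · exact hz (Or.inr ⟨t, ⟨h, ht.2⟩, rfl⟩)
    · exact (hε' ⟨ht0, h.trans_lt hm.2⟩).2.1 hzc

/-- In the convex side of the triangle `o u y`, the edge from `o` to a vertex `a` starts on the
side of the triangle containing `a`. -/
theorem IsConvexSideOf.sameSide_of_germSide {q : ℝ × ℝ}
    (hS : D.IsConvexSideOf (closure (connectedComponentIn (D.triangle o u y)ᶜ q)) o u y)
    (huo : u ≠ o) (hyo : y ≠ o) (huy : u ≠ y) (ha : D.IsArcParam o a fa) (hao : a ≠ o)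
    (hq : q ∉ D.triangle o u y) (hqa : SameSide (D.triangle o u y) q (D.vert a))
    (hp : GermSide (D.triangle o u y) fa p) : SameSide (D.triangle o u y) q p := by
  obtain ⟨fu, hu⟩ := exists_isArcParam (D := D) huo.symm
  obtain ⟨fy, hy⟩ := exists_isArcParam (D := D) hyo.symm
  have hcomp : connectedComponentIn (D.triangle o u y)ᶜ q =
      {z | SameSide (D.triangle o u y) q z} := by
    ext z
    exact SameSide.iff_mem_connectedComponentIn.symm
  rw [hcomp] at hS
  have hsub := hS.2 o a hao.symm (vert_mem_closure hu hy huo hyo huy hq) (subset_closure hqa)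
  obtain ⟨t, ht, ht'⟩ := (Filter.Eventually.and hp ha.eventually_mem).exists
  obtain ⟨z, hz, hz'⟩ := mem_closure_iff_nhds.1 (hsub ht'.1) _
    (SameSide.eventually (isCompact_triangle huo.symm huy hyo.symm).isClosed ht.left_notMem)
  exact (SameSide.trans hz' (SameSide.symm hz)).trans ht

theorem Crosses.exists_mem_arc {z : Fin n} (h : D.Crosses s(u, y) s(z, o)) :
    ∃ x, x ∈ D.arc o z ∧ x ∈ D.arc u y :=
  let ⟨_, x, hx, _⟩ := h
  ⟨x, D.arc_symm z o ▸ hx.2, hx.1⟩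

theorem disjoint_arc_of_not_badWitness {vs : Fin n} {lab : Fin (n - 1) → Fin n}
    (hlab : range lab = {x | x ≠ vs}) {a b : Fin (n - 1)} (hab : finCycSucc a = b)
    (h : ∀ w, ¬ D.BadWitness vs lab a w) {w : Fin n} (hw : w ≠ vs)
    (hwa : w ≠ lab a) (hwb : w ≠ lab b) : Disjoint (D.arc vs w) (D.arc (lab a) (lab b)) := by
  rw [disjoint_left]
  intro x hx hx'
  obtain ⟨w, rfl⟩ : w ∈ range lab := hlab ▸ hw
  have ha : lab a ≠ vs := (hlab ▸ mem_range_self a : lab a ∈ {x | x ≠ vs})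
  have hb : lab b ≠ vs := (hlab ▸ mem_range_self b : lab b ∈ {x | x ≠ vs})
  refine h w ?_
  rw [BadWitness, hab]
  refine ⟨by simp [ha, hb], x, ⟨hx', (D.arc_symm vs (lab w) ▸ hx : x ∈ D.arc (lab w) vs)⟩, ?_⟩
  rintro ⟨c, hc, hc', -⟩
  rw [Sym2.mem_iff] at hc hc'
  rcases hc with rfl | rfl <;> rcases hc' with hc' | hc'
  exacts [hwa hc'.symm, ha hc', hwb hc'.symm, hb hc']

/-- If no edge between consecutive labels up to `d` is bad, then no edge from `lab u` to `lab y`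
with `u ≤ d < y` crosses star edges with labels on both sides of `u` up to `d`. -/
theorem Convex.not_crosses_and_crosses (hD : D.Convex) {vs : Fin n} {lab : Fin (n - 1) → Fin n}
    (hlab : D.IsRotationLabeling vs lab) {d u y z₁ z₂ : Fin (n - 1)}
    (hbad : ∀ x < d, ∀ w, ¬ D.BadWitness vs lab x w) (hdy : d < y) (hz₁ : 0 < (z₁ : ℕ))
    (hz₁u : z₁ < u) (huz₂ : u < z₂) (hz₂ : z₂ < d) :
    ¬ (D.Crosses s(lab u, lab y) s(lab z₁, vs) ∧ D.Crosses s(lab u, lab y) s(lab z₂, vs)) := by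
  rintro ⟨hc₁, hc₂⟩
  obtain ⟨hinj, hrange, hrot⟩ := hlab
  have hvs : ∀ x, lab x ≠ vs := fun x => (hrange ▸ mem_range_self x : lab x ∈ {x | x ≠ vs})
  have hlt : ∀ {x x'}, x < x' → lab x ≠ lab x' := fun h => hinj.ne h.ne
  choose f hf using fun x => exists_isArcParam (D := D) (hvs x).symm
  have huy : u < y := (huz₂.trans hz₂).trans hdy
  have hu := hvs u
  have hy := hvs y
  have huy' := hlt huy
  obtain ⟨g, hg⟩ := exists_isArcParam (D := D) huy'
  obtain ⟨x₁, hx₁, hx₁'⟩ := hc₁.exists_mem_arc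
  obtain ⟨x₂, hx₂, hx₂'⟩ := hc₂.exists_mem_arc
  set T := D.triangle vs (lab u) (lab y) with hT
  have hz₂y := hz₂.trans hdy
  have hgerm : ∀ x, x ≠ u → x ≠ y → ∃ p, GermSide T (f x) p := fun x hxu hxy =>
    (hf x).exists_germSide (finite_arc_inter_triangle hu.symm huy' hy.symm (hvs x).symm
      (by simp [hinj.ne hxu, hu.symm]) (by simp [hu.symm, hy.symm])
      (by simp [hinj.ne hxy, hy.symm]))
  have hopp : ∀ {x x' p}, x < u → u < x' → x' < y → GermSide T (f x) p → ¬ GermSide T (f x') p := by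
    intro x x' p hx hx' hx'y h h'
    obtain ⟨q, hq, hq'⟩ := exists_germSide_of_germSide (hf x) (hf x') (hf u) (hf y) (hvs x)
      (hvs x') hu hy (hlt (hx.trans hx')) huy' h h'
    exact (hrot x u x' y hx hx' hx'y).false_of_germSide (hf u) (hf y) hq hq'
  obtain ⟨p₁, hp₁⟩ := hgerm z₁ hz₁u.ne (hz₁u.trans huy).ne
  obtain ⟨p₂, hp₂⟩ := hgerm z₂ huz₂.ne' hz₂y.ne
  have hp₁T : p₁ ∉ T := (hp₁.unique hp₁).left_notMem
  have hp₂T : p₂ ∉ T := (hp₂.unique hp₂).left_notMem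
  have hp₁₂ : ¬ SameSide T p₁ p₂ := fun h => hopp hz₁u huz₂ hz₂y (hp₁.trans h) hp₂
  have hnot₁ : ∀ {q}, q ∉ T → ¬ SameSide T p₁ q → SameSide T p₂ q := fun hq h =>
    sameSide_of_not_sameSide (hf z₁) hg (hvs z₁) hu hy (hlt hz₁u) (hlt (hz₁u.trans huy)) huy'
      hx₁ hx₁' hp₁ hp₂T hq hp₁₂ h
  have hnot₂ : ∀ {q}, q ∉ T → ¬ SameSide T p₂ q → SameSide T p₁ q := fun hq h =>
    sameSide_of_not_sameSide (hf z₂) hg (hvs z₂) hu hy (hlt huz₂).symm (hlt hz₂y) huy'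
      hx₂ hx₂' hp₂ hp₁T hq (fun h => hp₁₂ h.symm) h
  have hg₁ : ∀ x < u, GermSide T (f x) p₁ := by
    intro x hx
    obtain ⟨q, hq⟩ := hgerm x hx.ne (hx.trans huy).ne
    exact hq.trans (hnot₂ (hq.unique hq).left_notMem fun h =>
      hopp hx huz₂ hz₂y (hq.trans h.symm) hp₂).symm
  have hg₂ : ∀ x, u < x → x < y → GermSide T (f x) p₂ := by
    intro x hx hxy
    obtain ⟨q, hq⟩ := hgerm x hx.ne' hxy.ne
    exact hq.trans (hnot₁ (hq.unique hq).left_notMem fun h =>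
      hopp hz₁u hx hxy hp₁ (hq.trans h.symm)).symm
  have hvT : ∀ x, x ≠ u → x ≠ y → D.vert (lab x) ∉ T := by
    rintro x hxu hxy ((h | h) | h)
    · exact vert_notMem_arc hu.symm (hvs x) (hinj.ne hxu) h
    · exact vert_notMem_arc huy' (hinj.ne hxu) (hinj.ne hxy) h
    · exact vert_notMem_arc hy.symm (hvs x) (hinj.ne hxy) h
  have hsucc : ∀ {x x' : Fin (n - 1)}, (x' : ℕ) = x + 1 → finCycSucc x = x' := by
    intro x x' h
    ext
    simp only [finCycSucc]
    rw [Nat.mod_eq_of_lt (h ▸ x'.2), h]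
  have key : ∀ (b : Fin (n - 1)) (p : ℝ × ℝ), 0 < (b : ℕ) → b < d → b ≠ u →
      (∃ x, x ∈ D.arc vs (lab b) ∧ x ∈ D.arc (lab u) (lab y)) →
      (∀ x : Fin (n - 1), x ≠ u → (x : ℕ) ≤ b + 1 → (b : ℕ) ≤ x + 1 →
        GermSide T (f x) (D.vert (lab x)) ∧ GermSide T (f x) p) → False := by
    rintro b p hb0 hbd hbu ⟨x, hx, hx'⟩ hside
    have hbd' : (b : ℕ) < d := hbd
    have hdy' : (d : ℕ) < y := hdy
    obtain ⟨a, ha⟩ : ∃ a : Fin (n - 1), (b : ℕ) = a + 1 :=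
      ⟨⟨b - 1, (Nat.sub_le _ _).trans_lt b.2⟩, (Nat.succ_pred_eq_of_pos hb0).symm⟩
    obtain ⟨c, hc⟩ : ∃ c : Fin (n - 1), (c : ℕ) = b + 1 :=
      ⟨⟨b + 1, (Nat.succ_le_of_lt hbd').trans_lt d.2⟩, rfl⟩
    have hab : a < b := Fin.lt_def.2 (by omega)
    have hbc : b < c := Fin.lt_def.2 (by omega)
    have hcy : c < y := Fin.lt_def.2 (by omega)
    refine false_of_consecutive (hf a) (hf b) (hf c) (hf u) (hf y) hg (hvs a) (hvs b) (hvs c) hu hy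
      (hlt hab) (hlt hbc) (hlt (hab.trans hbc)) (hinj.ne hbu.symm)
      (hlt ((hab.trans hbc).trans hcy)) (hlt (hbc.trans hcy)) (hlt hcy) huy' ?_ ?_ ?_ ?_ ?_ ?_
      hx hx' (p := p)
    · exact fun w h1 h2 h3 => disjoint_arc_of_not_badWitness hrange (hsucc ha)
        (hbad a (hab.trans hbd)) h1 h2 h3
    · intro w h1 h2 h3
      rw [D.arc_symm (lab c)]
      exact disjoint_arc_of_not_badWitness hrange (hsucc hc) (hbad b hbd) h1 h3 h2
    · exact fun q h h' => (hrot a b c y hab hbc hcy).false_of_germSide (hf b) (hf y) h h'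
    · exact fun h => hside a (fun h' => h (h' ▸ rfl)) (by omega) (by omega)
    · exact hside b hbu (by omega) (by omega)
    · exact fun h => hside c (fun h' => h (h' ▸ rfl)) (by omega) (by omega)
  obtain ⟨w₁, hw₁u, hw₁⟩ : ∃ x < u, ¬ SameSide T p₁ (D.vert (lab x)) := by
    by_contra! h
    refine key z₁ p₁ hz₁ (hz₁u.trans (huz₂.trans hz₂)) hz₁u.ne ⟨x₁, hx₁, hx₁'⟩ fun x hxu hx _ => ?_
    have hxu' : x < u := (Fin.le_def.2 (hx.trans (Nat.succ_le_of_lt hz₁u))).lt_of_ne hxu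
    exact ⟨(hg₁ x hxu').trans (h x hxu'), hg₁ x hxu'⟩
  obtain ⟨w₂, hw₂u, hw₂y, hw₂⟩ : ∃ x, u < x ∧ x < y ∧ ¬ SameSide T p₂ (D.vert (lab x)) := by
    by_contra! h
    refine key z₂ p₂ ((Nat.zero_le _).trans_lt huz₂) hz₂ huz₂.ne' ⟨x₂, hx₂, hx₂'⟩
      fun x hxu hx hx' => ?_
    have h1 : (u : ℕ) < z₂ := huz₂
    have h2 : (z₂ : ℕ) < d := hz₂
    have h3 : (d : ℕ) < y := hdy
    have hxu' : u < x := (Fin.le_def.2 (by omega) : u ≤ x).lt_of_ne hxu.symm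
    have hxy : x < y := Fin.lt_def.2 (by omega)
    exact ⟨(hg₂ x hxu' hxy).trans (h x hxu' hxy), hg₂ x hxu' hxy⟩
  obtain ⟨S, hS⟩ := hD vs (lab u) (lab y) hu.symm huy' hy.symm
  obtain ⟨⟨p₀, hp₀, rfl⟩, -⟩ := id hS
  by_cases h : SameSide T p₁ p₀
  · exact hp₁₂ (h.trans (hS.sameSide_of_germSide hu hy huy' (hf w₂) (hvs w₂) hp₀
      (h.symm.trans (hnot₂ (hvT w₂ hw₂u.ne' hw₂y.ne) hw₂)) (hg₂ w₂ hw₂u hw₂y)))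
  · exact h (hS.sameSide_of_germSide hu hy huy' (hf w₁) (hvs w₁) hp₀
      ((hnot₁ hp₀ h).symm.trans (hnot₁ (hvT w₁ hw₁u.ne (hw₁u.trans huy).ne) hw₁))
      (hg₁ w₁ hw₁u)).symm

end SimpleDrawing

/-- With `m ≥ 2` bad edges as in the standard labeling (sidedness and nestedness), and the
blocks `L i` and `R i`: no edge `{lab u, lab y}` with `u ∈ L i` and `y ∈ R i` crosses two
star edges `{lab z₁, vs}` and `{lab z₂, vs}` with `z₁ < u < z₂` and `z₁, z₂ ∈ L i`. -/
theorem crossings_only_one_side (n : ℕ) (D : SimpleDrawing n) (hD : D.Convex)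
    (vs : Fin n) (lab : Fin (n - 1) → Fin n) (hlab : D.IsRotationLabeling vs lab)
    (m : ℕ) (hm : 2 ≤ m) (v wL wR : ℕ → Fin (n - 1))
    (hmono : ∀ i j, i < j → j < m → v i < v j)
    (hbadall : ∀ x w, D.BadWitness vs lab x w → ∃ i, i < m ∧ x = v i)
    (hwitL : ∀ i, i < m → D.BadWitness vs lab (v i) (wL i))
    (hwitR : ∀ i, i < m → D.BadWitness vs lab (v i) (wR i))
    (hwitLR : ∀ i, i < m → ∀ w, D.BadWitness vs lab (v i) w → wL i ≤ w ∧ w ≤ wR i)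
    (hside : ∀ x w, D.BadWitness vs lab x w → w < x)
    (hnest : ∀ x x' w w', D.BadWitness vs lab x w → D.BadWitness vs lab x' w' → x < x' → w' < w)
    :
    ∀ i, i + 1 < m → ∀ u y z₁ z₂ : Fin (n - 1),
      (wR (i+1) < u ∧ u < wL i) →
      (finCycSucc (v i) ≤ y ∧ y ≤ v (i+1)) →
      (wR (i+1) < z₁ ∧ z₁ < wL i) → (wR (i+1) < z₂ ∧ z₂ < wL i) →
      z₁ < u → u < z₂ →
      ¬(D.Crosses s(lab u, lab y) s(lab z₁, vs) ∧
        D.Crosses s(lab u, lab y) s(lab z₂, vs)) := by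
  intro i hi u y z₁ z₂ hu hy hz₁ hz₂ h₁ h₂
  have hwv := hside _ _ (hwitL i (by omega))
  have hvy : v i < y := by
    have h := Fin.lt_def.1 (hmono i (i + 1) (by omega) hi)
    refine lt_of_lt_of_le (Fin.lt_def.2 ?_) hy.1
    simp only [finCycSucc]
    rw [Nat.mod_eq_of_lt (by omega)]
    omega
  refine hD.not_crosses_and_crosses hlab (d := wL i) (fun x hx w hw => ?_) (hwv.trans hvy)
    ((Nat.zero_le _).trans_lt hz₁.1) h₁ h₂ hz₂.2
  obtain ⟨j, hj, rfl⟩ := hbadall x w hw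
  rcases lt_trichotomy j i with h | rfl | h
  · exact lt_asymm hx ((hnest _ _ _ _ (hwitL j hj) (hwitL i (by omega))
      (hmono j i h (by omega))).trans (hside _ _ (hwitL j hj)))
  · exact lt_asymm hx hwv
  · exact lt_asymm hx (hwv.trans (hmono i j h hj))
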